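/- arXiv:2408.07863 — 3 statements merged into one kernel-verified Lean document; each statement's English description precedes it below -/
import Mathlib

section
/- The number of interlacing triangular arrays of rank 4 and height 3 is 191232. -/
/-- Twice the horizontal coordinate `h(i,j,k) = i*n + j - (n+k)/2` of an entry
`T^(i)_(j,k)` of a triangular array of height `n` (doubled to stay in `ℤ`). -/
def Hc (n i j k : ℕ) : ℤ :=
  2 * ((i : ℤ) * (n : ℤ) + (j : ℤ)) - ((n : ℤ) + (k : ℤ))

/-- `T` is an interlacing triangular array of rank `m` and height `n`:
entries `T i j k ∈ {1,…,m}` for `1 ≤ i ≤ m`, `1 ≤ j ≤ k ≤ n`;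
(a) each value `a ∈ {1,…,m}` occurs exactly `k` times in row `k`;
(b) any two equal entries of row `k` have an interlacing equal entry in row `k-1`
strictly between them in horizontal coordinate. -/
def IsITA (m n : ℕ) (T : ℕ → ℕ → ℕ → ℕ) : Prop :=
  (∀ i j k, 1 ≤ i → i ≤ m → 1 ≤ j → j ≤ k → k ≤ n → T i j k ∈ Finset.Icc 1 m) ∧
  (∀ k, 1 ≤ k → k ≤ n → ∀ a ∈ Finset.Icc 1 m,
      ((Finset.Icc 1 m ×ˢ Finset.Icc 1 k).filter (fun p => T p.1 p.2 k = a)).card = k) ∧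
  (∀ k, 1 ≤ k → k ≤ n → ∀ i j i' j',
      1 ≤ i → i ≤ m → 1 ≤ j → j ≤ k → 1 ≤ i' → i' ≤ m → 1 ≤ j' → j' ≤ k →
      T i j k = T i' j' k → Hc n i j k < Hc n i' j' k →
      ∃ i'' j'', 1 ≤ i'' ∧ i'' ≤ m ∧ 1 ≤ j'' ∧ j'' ≤ k - 1 ∧
        T i'' j'' (k - 1) = T i j k ∧
        Hc n i j k < Hc n i'' j'' (k - 1) ∧ Hc n i'' j'' (k - 1) < Hc n i' j' k)

/-- The set of interlacing triangular arrays of rank `m` and height `n`,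
normalized to be `0` outside the support `1 ≤ i ≤ m`, `1 ≤ j ≤ k ≤ n`. -/
def ITAFull (m n : ℕ) : Set (ℕ → ℕ → ℕ → ℕ) :=
  {T | IsITA m n T ∧ ∀ i j k, ¬(1 ≤ i ∧ i ≤ m ∧ 1 ≤ j ∧ j ≤ k ∧ k ≤ n) → T i j k = 0}

/-! We read the array as a word of length 24 in order of horizontal coordinate, and count
the words by a transfer-matrix computation on per-value row counts. -/

namespace ITAaux

/-- row of the slot `t` -/
def rho (t : ℕ) : ℕ :=
  match t % 6 with
  | 0 => 3
  | 1 => 2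
  | 2 => 3
  | 3 => 1
  | 4 => 2
  | _ => 3

/-- block of the slot `t` -/
def ii (t : ℕ) : ℕ := t / 6 + 1

/-- index within the row of the block of the slot `t` -/
def jj (t : ℕ) : ℕ :=
  match t % 6 with
  | 0 => 1
  | 1 => 1
  | 2 => 2
  | 3 => 1
  | 4 => 2
  | _ => 3

/-- slot of a position -/
def idx (i j k : ℕ) : ℕ :=
  6 * (i - 1) + (if k = 1 then 3 else if k = 2 then (if j = 1 then 1 else 4)
    else (if j = 1 then 0 else if j = 2 then 2 else 5))

def Supp (i j k : ℕ) : Prop := 1 ≤ i ∧ i ≤ 4 ∧ 1 ≤ j ∧ j ≤ k ∧ k ≤ 3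

instance (i j k : ℕ) : Decidable (Supp i j k) := by unfold Supp; infer_instance

lemma supp_t : ∀ t < 24, Supp (ii t) (jj t) (rho t) ∧ idx (ii t) (jj t) (rho t) = t := by
  decide

lemma idx_lt {i j k : ℕ} (h : Supp i j k) :
    idx i j k < 24 ∧ ii (idx i j k) = i ∧ jj (idx i j k) = j ∧ rho (idx i j k) = k := by
  obtain ⟨h1, h2, h3, h4, h5⟩ := h
  have h6 : j ≤ 3 := by omega
  have h7 : 1 ≤ k := by omega
  interval_cases i <;> interval_cases k <;> interval_cases j <;> first | omega | decide

lemma Hc_lt : ∀ t < 24, ∀ u < 24, (rho t = rho u ∨ rho t + 1 = rho u ∨ rho u + 1 = rho t) →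
    (Hc 3 (ii t) (jj t) (rho t) < Hc 3 (ii u) (jj u) (rho u) ↔ t < u) := by
  decide +kernel

/-! ### The counting part -/

def inc (t : ℕ) : ℕ := 16 ^ (rho t - 1)

def okb (d : ℕ) : Bool :=
  Nat.beq d 0 || Nat.beq d 256 || Nat.beq d 272 || Nat.beq d 528 || Nat.beq d 273 ||
    Nat.beq d 529 || Nat.beq d 545 || Nat.beq d 801

/-- final state -/
def fin : ℕ := 801 * (1 + 4096 + 4096 ^ 2 + 4096 ^ 3)

def Run : (n t s : ℕ) → (Fin n → Fin 4) → Prop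
  | 0, _, s, _ => s = fin
  | n + 1, t, s, w =>
    okb ((s + 4096 ^ (w 0 : ℕ) * inc t) / 4096 ^ (w 0 : ℕ) % 4096) = true ∧
      Run n (t + 1) (s + 4096 ^ (w 0 : ℕ) * inc t) (fun i => w i.succ)

def cnt : ℕ → ℕ → ℕ → ℕ
  | 0, _, s => if s = fin then 1 else 0
  | n + 1, t, s => ∑ a : Fin 4,
      if okb ((s + 4096 ^ (a : ℕ) * inc t) / 4096 ^ (a : ℕ) % 4096) = true then
        cnt n (t + 1) (s + 4096 ^ (a : ℕ) * inc t) else 0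

open Classical in
lemma card_run (n : ℕ) : ∀ t s, Fintype.card {w : Fin n → Fin 4 // Run n t s w} = cnt n t s := by
  induction n with
  | zero =>
    intro t s
    by_cases h : s = fin
    · rw [Fintype.card_eq_one_iff.2 ⟨⟨Fin.elim0, h⟩, fun y => Subtype.ext (Subsingleton.elim _ _)⟩]
      simp [cnt, h]
    · rw [Fintype.card_eq_zero_iff.2 ⟨fun w => h w.2⟩]
      simp [cnt, h]
  | succ n ih =>
    intro t s
    let e : {w : Fin (n + 1) → Fin 4 // Run (n + 1) t s w} ≃
        (a : Fin 4) × {w : Fin n → Fin 4 //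
          okb ((s + 4096 ^ (a : ℕ) * inc t) / 4096 ^ (a : ℕ) % 4096) = true ∧
          Run n (t + 1) (s + 4096 ^ (a : ℕ) * inc t) w} :=
      { toFun := fun w => ⟨w.1 0, fun i => w.1 i.succ, w.2⟩
        invFun := fun p => ⟨Fin.cons p.1 p.2.1, by
          have := p.2.2
          simpa [Run] using this⟩
        left_inv := fun w => by
          apply Subtype.ext
          funext i
          refine Fin.cases ?_ (fun j => ?_) i <;> simp
        right_inv := fun p => by
          rcases p with ⟨a, w, h⟩
          rfl }
    rw [Fintype.card_congr e, Fintype.card_sigma]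
    simp only [cnt]
    refine Finset.sum_congr rfl fun a _ => ?_
    split_ifs with h
    · rw [← ih]
      exact Fintype.card_congr (Equiv.subtypeEquivRight fun w => by simp [h])
    · rw [Fintype.card_eq_zero_iff]
      exact ⟨fun w => h w.2.1⟩

def wsum (f : ℕ → ℕ) : List (ℕ × ℕ) → ℕ
  | [] => 0
  | p :: l => p.2 * f p.1 + wsum f l

def force {α : Type} (x : ℕ) (k : ℕ → α) : α :=
  @Nat.rec (fun _ => α) (k 0) (fun n _ => k (Nat.succ n)) x

lemma force_eq {α : Type} (x : ℕ) (k : ℕ → α) : force x k = k x := by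
  cases x <;> rfl

/-- normalize a list of pairs before passing it on -/
def fl {α : Type} (l : List (ℕ × ℕ)) : (List (ℕ × ℕ) → α) → α :=
  @List.rec (ℕ × ℕ) (fun _ => (List (ℕ × ℕ) → α) → α) (fun k => k [])
    (fun p _ ih k => force p.1 fun s => force p.2 fun m => ih fun r => k ((s, m) :: r)) l

lemma fl_eq {α : Type} (l : List (ℕ × ℕ)) (k : List (ℕ × ℕ) → α) : fl l k = k l := by
  induction l generalizing k with
  | nil => rfl
  | cons p l ih =>
    change (force p.1 fun s => force p.2 fun m => fl l fun r => k ((s, m) :: r)) = _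
    simp only [force_eq, ih]

def mv (q b : ℕ) : List (ℕ × ℕ) → List (ℕ × ℕ)
  | [] => []
  | p :: l => force (p.1 + q) fun s =>
      bif okb (s / b % 4096) then (s, p.2) :: mv q b l else mv q b l

def merge : ℕ → List (ℕ × ℕ) → List (ℕ × ℕ) → List (ℕ × ℕ)
  | 0, l, l' => l ++ l'
  | n + 1, l, l' =>
    match l with
    | [] => l'
    | p :: r =>
      match l' with
      | [] => p :: r
      | p' :: r' =>
        bif Nat.beq p.1 p'.1 then force (p.2 + p'.2) fun m => (p.1, m) :: merge n r r'
        else bif Nat.ble p.1 p'.1 then p :: merge n r (p' :: r')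
        else p' :: merge n (p :: r) r'

def adv {α : Type} (t : ℕ) (l : List (ℕ × ℕ)) (k : List (ℕ × ℕ) → α) : α :=
  force (inc t) fun c =>
    fl (mv c 1 l) fun l0 => fl (mv (4096 * c) 4096 l) fun l1 =>
    fl (mv (4096 ^ 2 * c) (4096 ^ 2) l) fun l2 => fl (mv (4096 ^ 3 * c) (4096 ^ 3) l) fun l3 =>
    fl (merge 1000 l0 l1) fun l4 => fl (merge 1000 l2 l3) fun l5 => fl (merge 1000 l4 l5) k

def dp : ℕ → ℕ → List (ℕ × ℕ) → ℕ
  | 0, _, l => wsum (fun s => bif Nat.beq s fin then 1 else 0) l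
  | n + 1, t, l => adv t l fun r => dp n (t + 1) r

lemma wsum_append (f : ℕ → ℕ) (l l' : List (ℕ × ℕ)) :
    wsum f (l ++ l') = wsum f l + wsum f l' := by
  induction l with
  | nil => simp [wsum]
  | cons p l ih => simp [wsum, ih, add_assoc]

lemma wsum_merge (f : ℕ → ℕ) (n : ℕ) : ∀ l l', wsum f (merge n l l') = wsum f l + wsum f l' := by
  induction n with
  | zero => intro l l'; simp [merge, wsum_append]
  | succ n ih =>
    intro l l'
    match l, l' with
    | [], l' => simp [merge, wsum]
    | p :: r, [] => simp [merge, wsum]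
    | p :: r, p' :: r' =>
      simp only [merge, force_eq]
      cases h : Nat.beq p.1 p'.1
      · cases h2 : Nat.ble p.1 p'.1
        · simp only [cond_false, wsum, ih]; ring
        · simp only [cond_false, cond_true, wsum, ih]; ring
      · have h' := Nat.eq_of_beq_eq_true h
        simp only [cond_true, wsum, ih, h']; ring

lemma wsum_mv (f : ℕ → ℕ) (q b : ℕ) (l : List (ℕ × ℕ)) :
    wsum f (mv q b l) =
      wsum (fun s => if okb ((s + q) / b % 4096) = true then f (s + q) else 0) l := by
  induction l with
  | nil => rfl
  | cons p l ih =>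
    simp only [mv, force_eq]
    cases h : okb ((p.1 + q) / b % 4096)
    · simp [wsum, ih, h]
    · simp [wsum, ih, h]

lemma wsum_add (f g : ℕ → ℕ) (l : List (ℕ × ℕ)) :
    wsum (fun s => f s + g s) l = wsum f l + wsum g l := by
  induction l with
  | nil => rfl
  | cons p l ih => simp only [wsum, ih]; ring

lemma dp_eq (n : ℕ) : ∀ t l, dp n t l = wsum (cnt n t) l := by
  induction n with
  | zero =>
    intro t l
    simp only [dp]
    congr 1
    funext s
    simp only [cnt]
    cases h : Nat.beq s fin
    · have := Nat.ne_of_beq_eq_false h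
      simp [this]
    · have := Nat.eq_of_beq_eq_true h
      simp [this]
  | succ n ih =>
    intro t l
    simp only [dp, adv, fl_eq, ih, force_eq, wsum_merge, wsum_mv]
    simp only [← wsum_add]
    congr 1
    funext s
    simp [cnt, Fin.sum_univ_four, add_assoc]

lemma cnt_eq_dp (n : ℕ) : cnt n 0 0 = dp n 0 [(0, 1)] := by
  rw [dp_eq]
  simp [wsum]

/-- the computation, as a predicate -/
structure Chk (n N : ℕ) : Prop where
  out : Nat.beq (dp n 0 [(0, 1)]) N = true

lemma cnt_of (n N : ℕ) (h : Chk n N) : cnt n 0 0 = N :=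
  (cnt_eq_dp n).trans (Nat.eq_of_beq_eq_true h.out)

set_option maxHeartbeats 4000000 in
lemma dp_val : Chk 24 191232 := ⟨by decide +kernel⟩

lemma cnt_val : cnt 24 0 0 = 191232 := cnt_of 24 191232 dp_val

/-! ### Counts in words -/

def C (e : ℕ → ℕ) (k a n : ℕ) : ℕ := ((Finset.range n).filter fun t => rho t = k ∧ e t = a).card

def S (e : ℕ → ℕ) (n : ℕ) : ℕ := ∑ t ∈ Finset.range n, 4096 ^ e t * inc t

lemma C_zero (e : ℕ → ℕ) (k a : ℕ) : C e k a 0 = 0 := by simp [C]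

lemma C_succ (e : ℕ → ℕ) (k a n : ℕ) :
    C e k a (n + 1) = C e k a n + if rho n = k ∧ e n = a then 1 else 0 := by
  simp only [C, Finset.card_filter, Finset.sum_range_succ]

lemma rho_cases (t : ℕ) : rho t = 1 ∨ rho t = 2 ∨ rho t = 3 := by
  unfold rho
  split <;> simp

lemma C_row_zero (e : ℕ → ℕ) (a n : ℕ) : C e 0 a n = 0 := by
  simp only [C, Finset.card_eq_zero]
  apply Finset.filter_eq_empty_iff.2
  intro t _ h
  rcases rho_cases t with h' | h' | h' <;> omega

lemma C_le (e : ℕ → ℕ) (k a n : ℕ) (hn : n ≤ 24) : C e k a n ≤ 12 := by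
  have h1 : C e k a n ≤ ((Finset.range 24).filter fun t => rho t = k).card := by
    apply Finset.card_le_card
    intro t
    simp only [Finset.mem_filter, Finset.mem_range]
    rintro ⟨h, h', _⟩
    exact ⟨by omega, h'⟩
  refine h1.trans ?_
  by_cases hk : k ≤ 3
  · interval_cases k <;> decide
  · rw [Finset.filter_eq_empty_iff.2]
    · simp
    · intro t _ h
      rcases rho_cases t with h' | h' | h' <;> omega

def D (e : ℕ → ℕ) (a n : ℕ) : ℕ := C e 1 a n + 16 * C e 2 a n + 256 * C e 3 a n

lemma S_eq (e : ℕ → ℕ) (he : ∀ t, e t < 4) (n : ℕ) :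
    S e n = D e 0 n + 4096 * D e 1 n + 4096 ^ 2 * D e 2 n + 4096 ^ 3 * D e 3 n := by
  induction n with
  | zero => simp [S, D, C_zero]
  | succ n ih =>
    have : S e (n + 1) = S e n + 4096 ^ e n * inc n := by simp [S, Finset.sum_range_succ]
    rw [this, ih]
    simp only [D, C_succ, inc]
    have h4 := he n
    generalize e n = x at *
    rcases rho_cases n with h | h | h <;> rw [h] <;> interval_cases x <;> simp <;> ring

lemma D_lt (e : ℕ → ℕ) (a n : ℕ) (hn : n ≤ 24) : D e a n < 4096 := by
  have h1 := C_le e 1 a n hn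
  have h2 := C_le e 2 a n hn
  have h3 := C_le e 3 a n hn
  unfold D
  omega

lemma S_digit (e : ℕ → ℕ) (he : ∀ t, e t < 4) (n a : ℕ) (hn : n ≤ 24) (ha : a < 4) :
    S e n / 4096 ^ a % 4096 = D e a n := by
  rw [S_eq e he]
  have h0 := D_lt e 0 n hn
  have h1 := D_lt e 1 n hn
  have h2 := D_lt e 2 n hn
  have h3 := D_lt e 3 n hn
  interval_cases a <;> norm_num <;> omega

def Good (e : ℕ → ℕ) (a n : ℕ) : Prop :=
  C e 1 a n ≤ 1 ∧ C e 1 a n ≤ C e 2 a n ∧ C e 2 a n ≤ C e 1 a n + 1 ∧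
    C e 2 a n ≤ C e 3 a n ∧ C e 3 a n ≤ C e 2 a n + 1

lemma okb_iff (e : ℕ → ℕ) (a n : ℕ) (hn : n ≤ 24) : okb (D e a n) = true ↔ Good e a n := by
  have h1 := C_le e 1 a n hn
  have h2 := C_le e 2 a n hn
  have h3 := C_le e 3 a n hn
  simp only [okb, Bool.or_eq_true, Nat.beq_eq, D, Good]
  omega

lemma final_iff (e : ℕ → ℕ) (he : ∀ t, e t < 4) :
    S e 24 = fin ↔ ∀ a < 4, ∀ k, 1 ≤ k → k ≤ 3 → C e k a 24 = k := by
  constructor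
  · intro h a ha k hk hk'
    have h' := S_digit e he 24 a le_rfl ha
    have hf : fin / 4096 ^ a % 4096 = 801 := by interval_cases a <;> decide
    rw [h, hf] at h'
    have h1 := C_le e 1 a 24 le_rfl
    have h2 := C_le e 2 a 24 le_rfl
    have h3 := C_le e 3 a 24 le_rfl
    unfold D at h'
    interval_cases k <;> omega
  · intro h
    rw [S_eq e he]
    have hD : ∀ a < 4, D e a 24 = 801 := by
      intro a ha
      simp [D, h a ha]
    rw [hD 0 (by omega), hD 1 (by omega), hD 2 (by omega), hD 3 (by omega)]
    decide

lemma run_iff (e : ℕ → ℕ) (n : ℕ) : ∀ t (w : Fin n → Fin 4), (∀ i : Fin n, (w i : ℕ) = e (t + i)) →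
    (Run n t (S e t) w ↔
      (∀ u, t ≤ u → u < t + n → okb (S e (u + 1) / 4096 ^ e u % 4096) = true) ∧
        S e (t + n) = fin) := by
  induction n with
  | zero =>
    intro t w _
    simp only [Run, add_zero]
    constructor
    · intro h
      exact ⟨fun u h1 h2 => by omega, h⟩
    · exact fun h => h.2
  | succ n ih =>
    intro t w hw
    have h0 : ((w 0 : Fin 4) : ℕ) = e t := by simpa using hw 0
    have hS : S e t + 4096 ^ e t * inc t = S e (t + 1) := by simp [S, Finset.sum_range_succ]
    have := ih (t + 1) (fun i => w i.succ) (fun i => by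
      rw [hw]; congr 1; simp; omega)
    simp only [Run, h0, hS, this]
    have e1 : t + 1 + n = t + (n + 1) := by omega
    rw [e1]
    constructor
    · rintro ⟨h1, h2, h3⟩
      refine ⟨fun u hu hu' => ?_, h3⟩
      rcases Nat.eq_or_lt_of_le hu with h | h
      · subst h; exact h1
      · exact h2 u h hu'
    · rintro ⟨h1, h2⟩
      exact ⟨h1 t le_rfl (by omega), fun u hu hu' => h1 u (by omega) hu', h2⟩

def CondA (e : ℕ → ℕ) : Prop := ∀ a < 4, ∀ k, 1 ≤ k → k ≤ 3 → C e k a 24 = k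

def CondB (e : ℕ → ℕ) : Prop := ∀ t < 24, ∀ u < 24, rho t = rho u → e t = e u → t < u →
  ∃ v, v < 24 ∧ rho v + 1 = rho t ∧ e v = e t ∧ t < v ∧ v < u

/-- count on an interval -/
def Ct (e : ℕ → ℕ) (k a x y : ℕ) : ℕ :=
  ((Finset.Ico x y).filter fun t => rho t = k ∧ e t = a).card

lemma C_add_Ct (e : ℕ → ℕ) (k a x y : ℕ) (h : x ≤ y) : C e k a x + Ct e k a x y = C e k a y := by
  simp only [C, Ct, Finset.card_filter]
  exact Finset.sum_range_add_sum_Ico _ h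

lemma Ct_le (e : ℕ → ℕ) (hB : CondB e) (k a x y : ℕ) (hy : y ≤ 24) :
    Ct e (k + 1) a x y ≤ Ct e k a x y + 1 := by
  apply Finset.card_le_of_interleaved
  intro t ht u hu htu _
  simp only [Finset.mem_filter, Finset.mem_Ico] at ht hu
  obtain ⟨v, hv, h1, h2, h3, h4⟩ := hB t (by omega) u (by omega) (by omega) (by omega) htu
  refine ⟨v, ?_, h3, h4⟩
  simp only [Finset.mem_filter, Finset.mem_Ico]
  omega

lemma good_of_AB (e : ℕ → ℕ) (hA : CondA e) (hB : CondB e) (a n : ℕ) (ha : a < 4) (hn : n ≤ 24) :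
    Good e a n := by
  have key : ∀ k < 3, C e k a n ≤ C e (k + 1) a n ∧ C e (k + 1) a n ≤ C e k a n + 1 := by
    intro k hk
    have h1 := C_add_Ct e k a 0 n (by omega)
    have h2 := C_add_Ct e (k + 1) a 0 n (by omega)
    have h3 := C_add_Ct e k a n 24 hn
    have h4 := C_add_Ct e (k + 1) a n 24 hn
    have h5 := Ct_le e hB k a 0 n hn
    have h6 := Ct_le e hB k a n 24 le_rfl
    have h7 := hA a ha (k + 1) (by omega) (by omega)
    have h8 : C e k a 24 = k := by
      rcases Nat.eq_zero_or_pos k with h | h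
      · subst h; exact C_row_zero e a 24
      · exact hA a ha k h (by omega)
    rw [C_zero] at h1 h2
    omega
  have k0 := key 0 (by omega)
  have k1 := key 1 (by omega)
  have k2 := key 2 (by omega)
  rw [C_row_zero] at k0
  simp only [Nat.reduceAdd] at k0 k1 k2
  unfold Good
  omega

lemma good_all (e : ℕ → ℕ) (h : ∀ u < 24, Good e (e u) (u + 1)) (a n : ℕ) (hn : n ≤ 24) :
    Good e a n := by
  induction n with
  | zero => simp [Good, C_zero]
  | succ n ih =>
    by_cases hh : e n = a
    · subst hh; exact h n (by omega)
    · have := ih (by omega)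
      simpa [Good, C_succ, hh] using this

lemma C_mono (e : ℕ → ℕ) (k a : ℕ) {x y : ℕ} (h : x ≤ y) : C e k a x ≤ C e k a y := by
  have := C_add_Ct e k a x y h
  omega

lemma B_of_good (e : ℕ → ℕ) (h : ∀ a n, n ≤ 24 → Good e a n) : CondB e := by
  intro t ht u hu hr he htu
  obtain ⟨k, hk⟩ : ∃ k, rho t = k + 1 := by
    rcases rho_cases t with h | h | h
    · exact ⟨0, h⟩
    · exact ⟨1, h⟩
    · exact ⟨2, h⟩
  have hk3 : k < 3 := by
    rcases rho_cases t with h | h | h <;> omega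
  have key : ∀ n ≤ 24, C e k (e t) n ≤ C e (k + 1) (e t) n ∧
      C e (k + 1) (e t) n ≤ C e k (e t) n + 1 := by
    intro n hn
    have h1 := h (e t) n hn
    have h0 := C_row_zero e (e t) n
    unfold Good at h1
    interval_cases k <;> simp only [Nat.reduceAdd] <;> omega
  have a1 := (key t (by omega)).1
  have a2 := (key (u + 1) (by omega)).2
  have b1 : C e (k + 1) (e t) (t + 1) = C e (k + 1) (e t) t + 1 := by simp [C_succ, hk]
  have b2 : C e (k + 1) (e t) (u + 1) = C e (k + 1) (e t) u + 1 := by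
    rw [C_succ, if_pos ⟨by omega, he.symm⟩]
  have b3 : C e k (e t) (t + 1) = C e k (e t) t := by
    rw [C_succ, if_neg (by omega)]; simp
  have b4 : C e k (e t) (u + 1) = C e k (e t) u := by
    rw [C_succ, if_neg (by omega)]; simp
  have c1 := C_mono e (k + 1) (e t) (x := t + 1) (y := u) htu
  have c2 := C_add_Ct e k (e t) (t + 1) u htu
  have pos : 0 < Ct e k (e t) (t + 1) u := by omega
  obtain ⟨v, hv⟩ := Finset.card_pos.1 pos
  simp only [Finset.mem_filter, Finset.mem_Ico] at hv
  exact ⟨v, by omega, by omega, hv.2.2, by omega, by omega⟩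

/-- extension of a word -/
def ext (W : Fin 24 → Fin 4) (t : ℕ) : ℕ := if h : t < 24 then (W ⟨t, h⟩ : ℕ) else 0

lemma ext_lt (W : Fin 24 → Fin 4) (t : ℕ) : ext W t < 4 := by
  unfold ext
  split_ifs with h
  · exact (W ⟨t, h⟩).2
  · omega

lemma run_iff_AB (W : Fin 24 → Fin 4) :
    Run 24 0 0 W ↔ CondA (ext W) ∧ CondB (ext W) := by
  have he := ext_lt W
  have h := run_iff (ext W) 24 0 W (fun i => by simp [ext])
  have hS : S (ext W) 0 = 0 := by simp [S]
  rw [hS] at h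
  rw [h]
  simp only [zero_add, Nat.zero_le, forall_const]
  rw [final_iff _ he]
  have hok : (∀ u < 24, okb (S (ext W) (u + 1) / 4096 ^ ext W u % 4096) = true) ↔
      ∀ u < 24, Good (ext W) (ext W u) (u + 1) := by
    refine forall₂_congr fun u hu => ?_
    rw [S_digit _ he _ _ (by omega) (he u), okb_iff _ _ _ (by omega)]
  rw [hok]
  constructor
  · rintro ⟨h1, h2⟩
    exact ⟨h2, B_of_good _ fun a n hn => good_all _ h1 a n hn⟩
  · rintro ⟨h1, h2⟩
    exact ⟨fun u hu => good_of_AB _ h1 h2 _ _ (he u) (by omega), h1⟩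

/-- the array of a word -/
def F (W : Fin 24 → Fin 4) (i j k : ℕ) : ℕ := if Supp i j k then ext W (idx i j k) + 1 else 0

lemma F_slot (W : Fin 24 → Fin 4) (t : ℕ) (ht : t < 24) :
    F W (ii t) (jj t) (rho t) = ext W t + 1 := by
  have h := supp_t t ht
  rw [F, if_pos h.1, h.2]

lemma F_inj : Function.Injective F := by
  intro W W' h
  funext t
  have h1 := F_slot W t t.2
  have h2 := F_slot W' t t.2
  rw [h, h2] at h1
  apply Fin.ext
  simp only [ext, t.2, dite_true] at h1
  simpa using h1.symm

lemma card_row (W : Fin 24 → Fin 4) (k a : ℕ) (hk' : k ≤ 3) :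
    ((Finset.Icc 1 4 ×ˢ Finset.Icc 1 k).filter (fun p => F W p.1 p.2 k = a + 1)).card =
      C (ext W) k a 24 := by
  unfold C
  refine Finset.card_bij' (fun p _ => idx p.1 p.2 k) (fun t _ => (ii t, jj t)) ?_ ?_ ?_ ?_
  · rintro ⟨i, j⟩ hp
    simp only [Finset.mem_filter, Finset.mem_product, Finset.mem_Icc] at hp
    have hs : Supp i j k := ⟨by omega, by omega, by omega, by omega, hk'⟩
    obtain ⟨h1, h2, h3, h4⟩ := idx_lt hs
    simp only [Finset.mem_filter, Finset.mem_range]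
    refine ⟨h1, h4, ?_⟩
    have := hp.2
    rw [F, if_pos hs] at this
    omega
  · intro t ht
    simp only [Finset.mem_filter, Finset.mem_range] at ht
    obtain ⟨h1, h2, h3⟩ := ht
    have hs := (supp_t t h1).1
    have hF := F_slot W t h1
    subst h2
    simp only [Finset.mem_filter, Finset.mem_product, Finset.mem_Icc]
    unfold Supp at hs
    refine ⟨by omega, by omega⟩
  · rintro ⟨i, j⟩ hp
    simp only [Finset.mem_filter, Finset.mem_product, Finset.mem_Icc] at hp
    have hs : Supp i j k := ⟨by omega, by omega, by omega, by omega, hk'⟩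
    obtain ⟨h1, h2, h3, h4⟩ := idx_lt hs
    simp [h2, h3]
  · intro t ht
    simp only [Finset.mem_filter, Finset.mem_range] at ht
    obtain ⟨h1, h2, h3⟩ := ht
    subst h2
    exact (supp_t t h1).2

lemma F_mem_iff (W : Fin 24 → Fin 4) :
    F W ∈ ITAFull 4 3 ↔ CondA (ext W) ∧ CondB (ext W) := by
  constructor
  · rintro ⟨⟨_, ha, hb⟩, _⟩
    constructor
    · intro a ha' k hk hk'
      rw [← card_row W k a hk']
      exact ha k hk hk' (a + 1) (by simp only [Finset.mem_Icc]; omega)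
    · intro t ht u hu hr he htu
      have st := (supp_t t ht).1
      have su := (supp_t u hu).1
      rw [← hr] at su
      have ft := F_slot W t ht
      have fu := F_slot W u hu
      have hlt := (Hc_lt t ht u hu (Or.inl hr)).2 htu
      rw [← hr] at fu hlt
      unfold Supp at st su
      obtain ⟨i, j, h1, h2, h3, h4, h5, h6, h7⟩ := hb (rho t) (by omega) (by omega) (ii t) (jj t)
        (ii u) (jj u) (by omega) (by omega) (by omega) (by omega) (by omega) (by omega)
        (by omega) (by omega) (by omega) hlt
      have hs : Supp i j (rho t - 1) := ⟨by omega, by omega, by omega, by omega, by omega⟩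
      obtain ⟨g1, g2, g3, g4⟩ := idx_lt hs
      generalize idx i j (rho t - 1) = v at *
      have fv := F_slot W v g1
      have q1 := Hc_lt t ht v g1 (by omega)
      have q2 := Hc_lt v g1 u hu (by omega)
      rw [g2, g3, g4] at fv q1 q2
      rw [← hr] at q2
      exact ⟨v, g1, by omega, by omega, q1.1 h6, q2.1 h7⟩
  · rintro ⟨hA, hB⟩
    refine ⟨⟨?_, ?_, ?_⟩, ?_⟩
    · intro i j k h1 h2 h3 h4 h5
      have := ext_lt W (idx i j k)
      rw [F, if_pos ⟨h1, h2, h3, h4, h5⟩]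
      simp only [Finset.mem_Icc]; omega
    · intro k hk hk' a ha
      simp only [Finset.mem_Icc] at ha
      obtain ⟨b, rfl⟩ : ∃ b, a = b + 1 := ⟨a - 1, by omega⟩
      rw [card_row W k b hk']
      exact hA b (by omega) k hk hk'
    · intro k hk hk' i j i' j' h1 h2 h3 h4 h1' h2' h3' h4' hF hlt
      obtain ⟨g1, g2, g3, g4⟩ := idx_lt (⟨h1, h2, h3, h4, hk'⟩ : Supp i j k)
      obtain ⟨g1', g2', g3', g4'⟩ := idx_lt (⟨h1', h2', h3', h4', hk'⟩ : Supp i' j' k)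
      generalize idx i j k = t at *
      generalize idx i' j' k = u at *
      have ft := F_slot W t g1
      have fu := F_slot W u g1'
      have q := Hc_lt t g1 u g1' (by omega)
      rw [g2, g3, g4] at ft q
      rw [g2', g3', g4'] at fu q
      obtain ⟨v, hv, r1, r2, r3, r4⟩ := hB t g1 u g1' (by omega) (by omega) (q.1 hlt)
      have fv := F_slot W v hv
      have sv := (supp_t v hv).1
      have q1 := (Hc_lt t g1 v hv (by omega)).2 r3
      have q2 := (Hc_lt v hv u g1' (by omega)).2 r4
      have rk : rho v = k - 1 := by omega
      rw [g2, g3, g4] at q1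
      rw [g2', g3', g4'] at q2
      rw [rk] at q1 q2 fv sv
      unfold Supp at sv
      exact ⟨ii v, jj v, by omega, by omega, by omega, by omega, by omega, q1, q2⟩
    · intro i j k h
      exact if_neg h

lemma ITA_eq : ITAFull 4 3 = Set.image F {W | Run 24 0 0 W} := by
  ext T
  constructor
  · intro hT
    have hr := hT.1.1
    have hz := hT.2
    have hb : ∀ t : Fin 24, T (ii t) (jj t) (rho t) - 1 < 4 := by
      intro t
      obtain ⟨h1, h2, h3, h4, h5⟩ := (supp_t t t.2).1
      have := hr _ _ _ h1 h2 h3 h4 h5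
      simp only [Finset.mem_Icc] at this
      omega
    have hF : F (fun t => ⟨T (ii t) (jj t) (rho t) - 1, hb t⟩) = T := by
      funext i j k
      by_cases hs : Supp i j k
      · obtain ⟨g1, g2, g3, g4⟩ := idx_lt hs
        rw [F, if_pos hs, ITAaux.ext, dif_pos g1]
        simp only [g2, g3, g4]
        have := hr i j k hs.1 hs.2.1 hs.2.2.1 hs.2.2.2.1 hs.2.2.2.2
        simp only [Finset.mem_Icc] at this
        omega
      · rw [F, if_neg hs, hz i j k hs]
    refine ⟨_, ?_, hF⟩
    rw [Set.mem_ofPred_eq, run_iff_AB, ← F_mem_iff, hF]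
    exact hT
  · rintro ⟨W, hW, rfl⟩
    rw [Set.mem_ofPred_eq, run_iff_AB] at hW
    exact (F_mem_iff W).2 hW

end ITAaux

/-- The number of interlacing triangular arrays of rank `4` and height `3` is `191232`. -/
theorem card_ITA_4_3 : (ITAFull 4 3).ncard = 191232 := by
  classical
  rw [ITAaux.ITA_eq, Set.ncard_image_of_injective _ ITAaux.F_inj, ← ITAaux.cnt_val,
    ← ITAaux.card_run, ← Nat.card_eq_fintype_card]
  rfl
end

section
/- For every n ≥ 1 and every λ = (λ^{(1)},λ^{(2)},λ^{(3)}) ∈ ({1,2,3}^n)³, the number of interlacing triangular arrays of rank 3 and height n with top row λ equals the number of 0/1/10-puzzles on Δ_n with boundary conditions ∂(λ). -/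
/-- A `0/1/10`-puzzle on `Δ_n` (edges encoded as for `1/2/3`-puzzles): every edge is
labeled `0`, `1` or `10`, and around every face the three labels, read clockwise,
are either all equal or are `0, 1, 10` in clockwise cyclic order. -/
def IsPuzzle010 (n : ℕ) (Q : ℕ → ℕ → ℕ → ℕ) : Prop :=
  (∀ d x y, d < 3 → x + y < n → (Q d x y = 0 ∨ Q d x y = 1 ∨ Q d x y = 10)) ∧
  (∀ x y, x + y < n →
      (Q 1 x y = Q 2 x y ∧ Q 2 x y = Q 0 x y) ∨
      (Q 1 x y = 0 ∧ Q 2 x y = 10 ∧ Q 0 x y = 1) ∨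
      (Q 1 x y = 10 ∧ Q 2 x y = 1 ∧ Q 0 x y = 0) ∨
      (Q 1 x y = 1 ∧ Q 2 x y = 0 ∧ Q 0 x y = 10)) ∧
  (∀ x y, x + y + 1 < n →
      (Q 2 x y = Q 0 x (y + 1) ∧ Q 0 x (y + 1) = Q 1 (x + 1) y) ∨
      (Q 2 x y = 0 ∧ Q 0 x (y + 1) = 10 ∧ Q 1 (x + 1) y = 1) ∨
      (Q 2 x y = 10 ∧ Q 0 x (y + 1) = 1 ∧ Q 1 (x + 1) y = 0) ∨
      (Q 2 x y = 1 ∧ Q 0 x (y + 1) = 0 ∧ Q 1 (x + 1) y = 10))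

/-- The set of `0/1/10`-puzzles on `Δ_n`, normalized to `0` off the edge set. -/
def Puzzle010Full (n : ℕ) : Set (ℕ → ℕ → ℕ → ℕ) :=
  {Q | IsPuzzle010 n Q ∧ ∀ d x y, ¬(d < 3 ∧ x + y < n) → Q d x y = 0}

/-- The direction-dependent label conversion `∂` from `1/2/3`-labels to `0/1/10`-labels:
on edges parallel to the left side (`d = 1`): `2 ↦ 0`, `3 ↦ 1`, `1 ↦ 10`;
on edges parallel to the right side (`d = 2`): `1 ↦ 0`, `2 ↦ 1`, `3 ↦ 10`;
on horizontal edges (`d = 0`): `3 ↦ 0`, `1 ↦ 1`, `2 ↦ 10`. -/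
def conv (d l : ℕ) : ℕ :=
  if d = 1 then (if l = 2 then 0 else if l = 3 then 1 else 10)
  else if d = 2 then (if l = 1 then 0 else if l = 2 then 1 else 10)
  else (if l = 3 then 0 else if l = 1 then 1 else 10)

/-- Applying `∂` to every edge of a `1/2/3`-puzzle on `Δ_n`. -/
def QofP (n : ℕ) (P : ℕ → ℕ → ℕ → ℕ) : ℕ → ℕ → ℕ → ℕ :=
  fun d x y => if d < 3 ∧ x + y < n then conv d (P d x y) else 0

/-- Number of letters `a` among the first `p` entries of block `i` of row `r`. -/
def cntA (T : ℕ → ℕ → ℕ → ℕ) (r a i p : ℕ) : ℕ :=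
  ((Finset.Icc 1 p).filter (fun j => T i j r = a)).card

lemma cntA_zero (T : ℕ → ℕ → ℕ → ℕ) (r a i : ℕ) : cntA T r a i 0 = 0 := by
  simp [cntA]

lemma cntA_succ (T : ℕ → ℕ → ℕ → ℕ) (r a i p : ℕ) :
    cntA T r a i (p + 1) = cntA T r a i p + if T i (p + 1) r = a then 1 else 0 := by
  unfold cntA
  rw [← Finset.insert_Icc_right_eq_Icc_add_one (by omega : 1 ≤ p + 1), Finset.filter_insert]
  split_ifs with h
  · rw [Finset.card_insert_of_notMem (by simp)]
  · simp

/-- Number of letters `a` in row `r` at horizontal position `≤ t`. -/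
def posA (T : ℕ → ℕ → ℕ → ℕ) (n r a : ℕ) (t : ℤ) : ℕ :=
  ((Finset.Icc 1 3 ×ˢ Finset.Icc 1 r).filter
    (fun p => T p.1 p.2 r = a ∧ Hc n p.1 p.2 r ≤ t)).card

/-- Letters `a` in row `r` in blocks before `i` plus the first `p` letters of block `i`. -/
def preA (T : ℕ → ℕ → ℕ → ℕ) (r a i p : ℕ) : ℕ :=
  (if 1 < i then cntA T r a 1 r else if i = 1 then cntA T r a 1 p else 0) +
  (if 2 < i then cntA T r a 2 r else if i = 2 then cntA T r a 2 p else 0) +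
  (if 3 < i then cntA T r a 3 r else if i = 3 then cntA T r a 3 p else 0)

lemma card_prod_three (r : ℕ) (Pr : ℕ → ℕ → Prop) [∀ i j, Decidable (Pr i j)] :
    ((Finset.Icc 1 3 ×ˢ Finset.Icc 1 r).filter (fun p => Pr p.1 p.2)).card =
      ((Finset.Icc 1 r).filter (fun j => Pr 1 j)).card +
      ((Finset.Icc 1 r).filter (fun j => Pr 2 j)).card +
      ((Finset.Icc 1 r).filter (fun j => Pr 3 j)).card := by
  simp only [Finset.card_filter]
  rw [Finset.sum_product]
  have : Finset.Icc 1 3 = ({1, 2, 3} : Finset ℕ) := by rfl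
  rw [this]
  simp [add_assoc]

lemma posA_eq_preA (T : ℕ → ℕ → ℕ → ℕ) (n r a i p : ℕ) (t : ℤ) (hp : p ≤ r)
    (h : ∀ i' j', 1 ≤ i' → i' ≤ 3 → 1 ≤ j' → j' ≤ r →
      (Hc n i' j' r ≤ t ↔ (i' < i ∨ (i' = i ∧ j' ≤ p)))) :
    posA T n r a t = preA T r a i p := by
  unfold posA preA
  rw [card_prod_three r (fun i j => T i j r = a ∧ Hc n i j r ≤ t)]
  have key : ∀ b, 1 ≤ b → b ≤ 3 →
      ((Finset.Icc 1 r).filter (fun j => T b j r = a ∧ Hc n b j r ≤ t)).card =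
      (if b < i then cntA T r a b r else if b = i then cntA T r a b p else 0) := by
    intro b hb1 hb3
    split_ifs with h1 h2
    · unfold cntA
      congr 1
      apply Finset.filter_congr
      intro j hj
      rw [Finset.mem_Icc] at hj
      rw [h b j hb1 hb3 hj.1 hj.2]
      simp [h1]
    · unfold cntA
      congr 1
      ext j
      simp only [Finset.mem_filter, Finset.mem_Icc]
      constructor
      · rintro ⟨hj, hT, hH⟩
        rw [h b j hb1 hb3 hj.1 hj.2] at hH
        exact ⟨⟨hj.1, by omega⟩, hT⟩
      · rintro ⟨hj, hT⟩
        refine ⟨⟨hj.1, by omega⟩, hT, ?_⟩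
        rw [h b j hb1 hb3 hj.1 (by omega)]
        omega
    · rw [Finset.card_eq_zero, Finset.filter_eq_empty_iff]
      intro j hj
      rw [Finset.mem_Icc] at hj
      rw [h b j hb1 hb3 hj.1 hj.2]
      omega
  rw [key 1 (by omega) (by omega), key 2 (by omega) (by omega), key 3 (by omega) (by omega)]
  congr 2 <;> simp only [eq_comm]

lemma Hc_lt_of_block (n i j r i' j' r' : ℕ) (hi : i < i') (hj : j ≤ r) (hr : r ≤ n)
    (hr' : r' ≤ n) (hj' : 1 ≤ j') : Hc n i j r + 2 ≤ Hc n i' j' r' := by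
  unfold Hc
  have h1 : ((i : ℤ) + 1) * n ≤ (i' : ℤ) * n := by
    apply mul_le_mul_of_nonneg_right <;> omega
  have : ((i : ℤ) + 1) * n = i * n + n := by ring
  omega

lemma posA_up (T : ℕ → ℕ → ℕ → ℕ) (n k a i j : ℕ) (hk : k + 1 ≤ n) (hj : j ≤ k) :
    posA T n (k + 1) a (Hc n i (j + 1) (k + 1)) = preA T (k + 1) a i (j + 1) ∧
    posA T n (k + 1) a (Hc n i (j + 1) (k + 1) - 1) = preA T (k + 1) a i j ∧
    posA T n k a (Hc n i (j + 1) (k + 1)) = preA T k a i j ∧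
    posA T n k a (Hc n i (j + 1) (k + 1) - 1) = preA T k a i j := by
  refine ⟨?_, ?_, ?_, ?_⟩ <;>
  · refine posA_eq_preA _ _ _ _ _ _ _ (by omega) ?_
    intro i' j' h1 h3 hj1 hj2
    rcases lt_trichotomy i' i with h | h | h
    · have := Hc_lt_of_block n i' j' _ i (j + 1) (k + 1) h hj2 (by omega) hk (by omega)
      constructor
      · intro; exact Or.inl h
      · intro; omega
    · subst h
      unfold Hc
      push_cast
      omega
    · have h5 := fun r hr => Hc_lt_of_block n i (j + 1) (k + 1) i' j' r h (by omega) hk hr hj1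
      have h6 := h5 k (by omega)
      have h7 := h5 (k + 1) hk
      constructor
      · intro; omega
      · intro; omega

lemma card_row (T : ℕ → ℕ → ℕ → ℕ) (r a : ℕ) :
    ((Finset.Icc 1 3 ×ˢ Finset.Icc 1 r).filter (fun p => T p.1 p.2 r = a)).card =
      cntA T r a 1 r + cntA T r a 2 r + cntA T r a 3 r := by
  rw [card_prod_three r (fun i j => T i j r = a)]
  rfl

lemma Hc_inj (n r : ℕ) (hr : r ≤ n) : Set.InjOn (fun p : ℕ × ℕ => Hc n p.1 p.2 r)
    (Finset.Icc 1 3 ×ˢ Finset.Icc 1 r : Finset (ℕ × ℕ)) := by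
  rintro ⟨i, j⟩ h ⟨i', j'⟩ h' heq
  simp only [Finset.coe_product, Set.mem_prod, Finset.mem_coe, Finset.mem_Icc] at h h' heq
  rcases lt_trichotomy i i' with hh | hh | hh
  · have := Hc_lt_of_block n i j r i' j' r hh (by omega) hr hr (by omega)
    omega
  · subst hh
    unfold Hc at heq
    ext <;> simp
    omega
  · have := Hc_lt_of_block n i' j' r i j r hh (by omega) hr hr (by omega)
    omega

/-- The interlacing condition bounds the difference of prefix counts. -/
lemma posA_bounds (T : ℕ → ℕ → ℕ → ℕ) (n k a : ℕ) (hT : IsITA 3 n T) (hk : k + 1 ≤ n)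
    (ha : a ∈ Finset.Icc 1 3) (t : ℤ) :
    posA T n k a t ≤ posA T n (k + 1) a t ∧ posA T n (k + 1) a t ≤ posA T n k a t + 1 := by
  obtain ⟨h1, h2, h3⟩ := hT
  have gen : ∀ (Pt : ℤ → Prop) [DecidablePred Pt]
      (_ : ∀ x y z, x < z → z < y → Pt x → Pt y → Pt z),
      ((Finset.Icc 1 3 ×ˢ Finset.Icc 1 (k + 1)).filter
        (fun p => T p.1 p.2 (k + 1) = a ∧ Pt (Hc n p.1 p.2 (k + 1)))).card ≤
      ((Finset.Icc 1 3 ×ˢ Finset.Icc 1 k).filter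
        (fun p => T p.1 p.2 k = a ∧ Pt (Hc n p.1 p.2 k))).card + 1 := by
    intro Pt _ hPt
    rw [← Finset.card_image_of_injOn
        ((Hc_inj n (k + 1) hk).mono (Finset.coe_subset.2 (Finset.filter_subset _ _))),
      ← Finset.card_image_of_injOn
        ((Hc_inj n k (by omega)).mono (Finset.coe_subset.2 (Finset.filter_subset _ _)))]
    apply Finset.card_le_of_interleaved
    intro x hx y hy hxy _
    simp only [Finset.mem_image, Finset.mem_filter, Finset.mem_product, Finset.mem_Icc,
      Prod.exists] at hx hy ⊢
    obtain ⟨i, j, ⟨⟨hi, hj⟩, hTa, hP⟩, rfl⟩ := hx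
    obtain ⟨i', j', ⟨⟨hi', hj'⟩, hTa', hP'⟩, rfl⟩ := hy
    obtain ⟨i'', j'', q1, q2, q3, q4, q5, q6, q7⟩ := h3 (k + 1) (by omega) hk i j i' j'
      hi.1 hi.2 hj.1 hj.2 hi'.1 hi'.2 hj'.1 hj'.2 (by rw [hTa, hTa']) hxy
    simp only [Nat.add_sub_cancel] at q4 q5 q6 q7
    exact ⟨_, ⟨i'', j'', ⟨⟨⟨q1, q2⟩, q3, q4⟩, by rw [q5, hTa], hPt _ _ _ q6 q7 hP hP'⟩, rfl⟩,
      q6, q7⟩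
  have split : ∀ r, ((Finset.Icc 1 3 ×ˢ Finset.Icc 1 r).filter
        (fun p => T p.1 p.2 r = a)).card = posA T n r a t +
      ((Finset.Icc 1 3 ×ˢ Finset.Icc 1 r).filter
        (fun p => T p.1 p.2 r = a ∧ ¬ (Hc n p.1 p.2 r ≤ t))).card := by
    intro r
    unfold posA
    rw [← Finset.card_filter_add_card_filter_not (fun p : ℕ × ℕ => Hc n p.1 p.2 r ≤ t)]
    simp only [Finset.filter_filter]
  have g1 := gen (fun z => z ≤ t) (by intro x y z; omega)
  have g2 := gen (fun z => ¬ z ≤ t) (by intro x y z; omega)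
  have s1 := split (k + 1)
  have s2 := split k
  rw [h2 (k + 1) (by omega) hk a ha] at s1
  have s3 : ((Finset.Icc 1 3 ×ˢ Finset.Icc 1 k).filter (fun p => T p.1 p.2 k = a)).card = k := by
    rcases Nat.eq_zero_or_pos k with h | h
    · subst h; simp
    · exact h2 k h (by omega) a ha
  rw [s3] at s2
  unfold posA at *
  omega

lemma preA_bounds (T : ℕ → ℕ → ℕ → ℕ) (n k a i j : ℕ) (hT : IsITA 3 n T) (hk : k + 1 ≤ n)
    (ha : a ∈ Finset.Icc 1 3) (hj : j ≤ k) :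
    preA T k a i j ≤ preA T (k + 1) a i j ∧ preA T (k + 1) a i j ≤ preA T k a i j + 1 ∧
    preA T k a i j ≤ preA T (k + 1) a i (j + 1) ∧
    preA T (k + 1) a i (j + 1) ≤ preA T k a i j + 1 := by
  obtain ⟨e1, e2, e3, e4⟩ := posA_up T n k a i j hk hj
  have b1 := posA_bounds T n k a hT hk ha (Hc n i (j + 1) (k + 1))
  have b2 := posA_bounds T n k a hT hk ha (Hc n i (j + 1) (k + 1) - 1)
  rw [e1, e3] at b1
  rw [e2, e4] at b2
  exact ⟨b2.1, b2.2, b1.1, b1.2⟩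

lemma ita_total (T : ℕ → ℕ → ℕ → ℕ) (n k a : ℕ) (hT : IsITA 3 n T) (hk : k ≤ n)
    (ha : a ∈ Finset.Icc 1 3) : cntA T k a 1 k + cntA T k a 2 k + cntA T k a 3 k = k := by
  rw [← card_row]
  rcases Nat.eq_zero_or_pos k with h | h
  · subst h; simp
  · exact hT.2.1 k h (by omega) a ha

/-- Block 1 is frozen. -/
lemma ita_block1 (T : ℕ → ℕ → ℕ → ℕ) (n k : ℕ) (hT : IsITA 3 n T) (hk : k + 1 ≤ n) :
    ∀ j, j ≤ k → (∀ a ∈ Finset.Icc 1 3, cntA T (k + 1) a 1 j = cntA T k a 1 j) ∧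
      (1 ≤ j → T 1 j (k + 1) = T 1 j k) := by
  intro j
  induction j with
  | zero => intro _; simp [cntA_zero]
  | succ j ih =>
    intro hj
    obtain ⟨ih, -⟩ := ih (by omega)
    have hval := hT.1 1 (j + 1) k (by omega) (by omega) (by omega) (by omega) (by omega)
    have heq : T 1 (j + 1) (k + 1) = T 1 (j + 1) k := by
      obtain ⟨b1, -⟩ := preA_bounds T n k _ 1 (j + 1) hT hk hval hj
      simp only [preA, lt_irrefl, if_true, if_false, cntA_succ, ih _ hval] at b1
      by_contra hne
      simp [hne] at b1
    refine ⟨?_, fun _ => heq⟩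
    intro a ha
    rw [cntA_succ, cntA_succ, ih a ha, heq]

/-- Block 3 is frozen, up to a shift. -/
lemma ita_block3 (T : ℕ → ℕ → ℕ → ℕ) (n k : ℕ) (hT : IsITA 3 n T) (hk : k + 1 ≤ n) :
    ∀ d j, j + d = k → (∀ a ∈ Finset.Icc 1 3,
      preA T (k + 1) a 3 (j + 1) = preA T k a 3 j + 1) ∧
      (1 ≤ d → T 3 (j + 2) (k + 1) = T 3 (j + 1) k) := by
  intro d
  induction d with
  | zero =>
    intro j hj
    refine ⟨?_, by omega⟩
    intro a ha
    have t1 := ita_total T n (k + 1) a hT hk ha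
    have t2 := ita_total T n k a hT (by omega) ha
    have : j = k := by omega
    subst this
    simp [preA]
    omega
  | succ d ih =>
    intro j hj
    obtain ⟨ih, -⟩ := ih (j + 1) (by omega)
    have hval := hT.1 3 (j + 1) k (by omega) (by omega) (by omega) (by omega) (by omega)
    have st : ∀ r a p, preA T r a 3 (p + 1) = preA T r a 3 p +
        if T 3 (p + 1) r = a then 1 else 0 := by
      intro r a p
      simp [preA, cntA_succ, add_assoc]
    have heq : T 3 (j + 2) (k + 1) = T 3 (j + 1) k := by
      obtain ⟨-, -, -, b1⟩ := preA_bounds T n k _ 3 j hT hk hval (by omega)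
      have := ih _ hval
      rw [st _ _ (j + 1), st k _ j] at this
      by_contra hne
      simp [hne] at this
      omega
    refine ⟨?_, fun _ => heq⟩
    intro a ha
    have := ih _ ha
    rw [st _ _ (j + 1), st k _ j, show j + 1 + 1 = j + 2 from rfl, heq] at this
    omega

/-- Existence of the intermediate states (labels of the edges of the strip). -/
lemma ita_state (T : ℕ → ℕ → ℕ → ℕ) (n k : ℕ) (hT : IsITA 3 n T) (hk : k + 1 ≤ n) :
    ∀ x, x ≤ k → ∃ p q, p ∈ Finset.Icc 1 3 ∧ q ∈ Finset.Icc 1 3 ∧ ∀ a ∈ Finset.Icc 1 3,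
      preA T (k + 1) a 2 x = preA T k a 2 x + (if p = a then 1 else 0) ∧
      preA T (k + 1) a 2 (x + 1) + (if q = a then 1 else 0) = preA T k a 2 x + 1 := by
  have st : ∀ r a p, preA T r a 2 (p + 1) = preA T r a 2 p +
      if T 2 (p + 1) r = a then 1 else 0 := by
    intro r a p
    simp [preA, cntA_succ, add_assoc]
  have aux : ∀ x, x ≤ k → (∃ p ∈ Finset.Icc 1 3, ∀ a ∈ Finset.Icc 1 3,
      preA T (k + 1) a 2 x = preA T k a 2 x + (if p = a then 1 else 0)) →
      ∃ p q, p ∈ Finset.Icc 1 3 ∧ q ∈ Finset.Icc 1 3 ∧ ∀ a ∈ Finset.Icc 1 3,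
      preA T (k + 1) a 2 x = preA T k a 2 x + (if p = a then 1 else 0) ∧
      preA T (k + 1) a 2 (x + 1) + (if q = a then 1 else 0) = preA T k a 2 x + 1 := by
    rintro x hx ⟨p, hp, hpa⟩
    have hu := hT.1 2 (x + 1) (k + 1) (by omega) (by omega) (by omega) (by omega) (by omega)
    have hne : T 2 (x + 1) (k + 1) ≠ p := by
      intro h
      obtain ⟨-, -, -, b⟩ := preA_bounds T n k p 2 x hT hk hp hx
      rw [st, hpa p hp, h] at b
      simp at b
    refine ⟨p, 6 - p - T 2 (x + 1) (k + 1), hp, ?_, ?_⟩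
    · rw [Finset.mem_Icc] at *; omega
    · intro a ha
      refine ⟨hpa a ha, ?_⟩
      rw [st, hpa a ha]
      rw [Finset.mem_Icc] at *
      split_ifs <;> omega
  intro x
  induction x with
  | zero =>
    intro hx
    apply aux 0 hx
    refine ⟨T 1 (k + 1) (k + 1), hT.1 1 (k + 1) (k + 1) (by omega) (by omega) (by omega)
      (by omega) (by omega), ?_⟩
    intro a ha
    simp [preA, cntA_succ, cntA_zero, (ita_block1 T n k hT hk k le_rfl).1 a ha]
  | succ x ih =>
    intro hx
    apply aux (x + 1) hx
    obtain ⟨p, q, hp, hq, h⟩ := ih (by omega)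
    have hl := hT.1 2 (x + 1) k (by omega) (by omega) (by omega) (by omega) (by omega)
    have hne : T 2 (x + 1) k ≠ q := by
      intro he
      obtain ⟨b, -⟩ := preA_bounds T n k q 2 (x + 1) hT hk hq hx
      have := (h q hq).2
      rw [st k, he] at b
      simp at b this
      omega
    refine ⟨6 - q - T 2 (x + 1) k, ?_, ?_⟩
    · rw [Finset.mem_Icc] at *; omega
    · intro a ha
      have := (h a ha).2
      rw [st k]
      rw [Finset.mem_Icc] at *
      split_ifs at * <;> omega

/-- Three labels are exactly `1,2,3` in some order. -/
def Dist3 (a b c : ℕ) : Prop :=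
  (1 ≤ a ∧ a ≤ 3) ∧ (1 ≤ b ∧ b ≤ 3) ∧ (1 ≤ c ∧ c ≤ 3) ∧ a ≠ b ∧ b ≠ c ∧ a ≠ c

/-- `1/2/3`-puzzles: each face has three distinct labels. -/
def Puz123 (n : ℕ) (lam : ℕ → ℕ → ℕ) : Set (ℕ → ℕ → ℕ → ℕ) :=
  {P | (∀ x y, x + y < n → Dist3 (P 1 x y) (P 2 x y) (P 0 x y)) ∧
    (∀ x y, x + y + 1 < n → Dist3 (P 2 x y) (P 0 x (y + 1)) (P 1 (x + 1) y)) ∧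
    (∀ d x y, ¬(d < 3 ∧ x + y < n) → P d x y = 0) ∧
    ∀ j, 1 ≤ j → j ≤ n →
        P 1 0 (j - 1) = lam 1 j ∧ P 2 (j - 1) (n - j) = lam 2 j ∧ P 0 (n - j) 0 = lam 3 j}

/-- The array attached to a `1/2/3`-puzzle. -/
def TofP (n : ℕ) (P : ℕ → ℕ → ℕ → ℕ) : ℕ → ℕ → ℕ → ℕ := fun i j k =>
  if 1 ≤ i ∧ i ≤ 3 ∧ 1 ≤ j ∧ j ≤ k ∧ k ≤ n then
    (if i = 1 then P 1 0 (j - 1) else if i = 2 then P 2 (j - 1) (k - j) else P 0 (k - j) 0)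
  else 0

lemma TofP_one (n : ℕ) (P : ℕ → ℕ → ℕ → ℕ) (j k : ℕ) (hj : j + 1 ≤ k) (hk : k ≤ n) :
    TofP n P 1 (j + 1) k = P 1 0 j := by
  unfold TofP; rw [if_pos (by omega)]; simp

lemma TofP_two (n : ℕ) (P : ℕ → ℕ → ℕ → ℕ) (j k : ℕ) (hj : j + 1 ≤ k) (hk : k ≤ n) :
    TofP n P 2 (j + 1) k = P 2 j (k - (j + 1)) := by
  unfold TofP; rw [if_pos (by omega)]; simp

lemma TofP_three (n : ℕ) (P : ℕ → ℕ → ℕ → ℕ) (j k : ℕ) (hj : j + 1 ≤ k) (hk : k ≤ n) :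
    TofP n P 3 (j + 1) k = P 0 (k - (j + 1)) 0 := by
  unfold TofP; rw [if_pos (by omega)]; simp

section PtoT

variable {n : ℕ} {P : ℕ → ℕ → ℕ → ℕ}

lemma tofP_block1 (k a : ℕ) (hk : k + 1 ≤ n) : ∀ j, j ≤ k →
    cntA (TofP n P) (k + 1) a 1 j = cntA (TofP n P) k a 1 j := by
  intro j
  induction j with
  | zero => simp [cntA_zero]
  | succ j ih =>
    intro hj
    rw [cntA_succ, cntA_succ, ih (by omega), TofP_one _ _ _ _ (by omega) (by omega),
      TofP_one _ _ _ _ (by omega) (by omega)]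

lemma tofP_block3 (k a : ℕ) (hk : k + 1 ≤ n) : ∀ j, j ≤ k →
    cntA (TofP n P) (k + 1) a 3 (j + 1) = cntA (TofP n P) k a 3 j +
      if P 0 k 0 = a then 1 else 0 := by
  intro j
  induction j with
  | zero =>
    intro _
    rw [cntA_succ, cntA_zero, cntA_zero, TofP_three _ _ _ _ (by omega) (by omega)]
    simp
  | succ j ih =>
    intro hj
    rw [cntA_succ, ih (by omega), cntA_succ, TofP_three _ _ _ _ (by omega) (by omega),
      TofP_three _ _ _ _ (by omega) (by omega),
      show k + 1 - (j + 1 + 1) = k - (j + 1) by omega]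
    omega

lemma tofP_block2 (hP1 : ∀ x y, x + y < n → Dist3 (P 1 x y) (P 2 x y) (P 0 x y))
    (hP2 : ∀ x y, x + y + 1 < n → Dist3 (P 2 x y) (P 0 x (y + 1)) (P 1 (x + 1) y))
    (k a : ℕ) (hk : k + 1 ≤ n) (ha : 1 ≤ a ∧ a ≤ 3) : ∀ j, j ≤ k →
    (cntA (TofP n P) (k + 1) a 2 j + (if P 1 0 k = a then 1 else 0) =
      cntA (TofP n P) k a 2 j + (if P 1 j (k - j) = a then 1 else 0)) ∧
    (cntA (TofP n P) (k + 1) a 2 (j + 1) + (if P 1 0 k = a then 1 else 0) +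
      (if P 0 j (k - j) = a then 1 else 0) = cntA (TofP n P) k a 2 j + 1) := by
  have second : ∀ j, j ≤ k → (cntA (TofP n P) (k + 1) a 2 j + (if P 1 0 k = a then 1 else 0) =
      cntA (TofP n P) k a 2 j + (if P 1 j (k - j) = a then 1 else 0)) →
      (cntA (TofP n P) (k + 1) a 2 (j + 1) + (if P 1 0 k = a then 1 else 0) +
      (if P 0 j (k - j) = a then 1 else 0) = cntA (TofP n P) k a 2 j + 1) := by
    intro j hj h
    rw [cntA_succ, TofP_two _ _ _ _ (by omega) (by omega),
      show k + 1 - (j + 1) = k - j by omega]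
    have f := hP1 j (k - j) (by omega)
    unfold Dist3 at f
    generalize (if P 1 0 k = a then 1 else 0) = w at *
    split_ifs at * <;> omega
  intro j
  induction j with
  | zero =>
    intro hj
    have : cntA (TofP n P) (k + 1) a 2 0 + (if P 1 0 k = a then 1 else 0) =
      cntA (TofP n P) k a 2 0 + (if P 1 0 (k - 0) = a then 1 else 0) := by simp [cntA_zero]
    exact ⟨this, second 0 hj this⟩
  | succ j ih =>
    intro hj
    have h := (ih (by omega)).2
    have : cntA (TofP n P) (k + 1) a 2 (j + 1) + (if P 1 0 k = a then 1 else 0) =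
      cntA (TofP n P) k a 2 (j + 1) + (if P 1 (j + 1) (k - (j + 1)) = a then 1 else 0) := by
      rw [cntA_succ _ k, TofP_two _ _ _ _ (by omega) (by omega)]
      have f := hP2 j (k - (j + 1)) (by omega)
      rw [show k - (j + 1) + 1 = k - j by omega] at f
      unfold Dist3 at f
      generalize (if P 1 0 k = a then 1 else 0) = w at *
      split_ifs at * <;> omega
    exact ⟨this, second _ hj this⟩

lemma tofP_total (hP1 : ∀ x y, x + y < n → Dist3 (P 1 x y) (P 2 x y) (P 0 x y))
    (hP2 : ∀ x y, x + y + 1 < n → Dist3 (P 2 x y) (P 0 x (y + 1)) (P 1 (x + 1) y))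
    (a : ℕ) (ha : 1 ≤ a ∧ a ≤ 3) : ∀ k, k ≤ n →
    cntA (TofP n P) k a 1 k + cntA (TofP n P) k a 2 k + cntA (TofP n P) k a 3 k = k := by
  intro k
  induction k with
  | zero => simp [cntA_zero]
  | succ k ih =>
    intro hk
    have h0 := ih (by omega)
    have h1 := tofP_block1 (P := P) k a hk k le_rfl
    have h2 := (tofP_block2 hP1 hP2 k a hk ha k le_rfl).2
    have h3 := tofP_block3 (P := P) k a hk k le_rfl
    rw [cntA_succ _ _ _ 1, h1, h3, TofP_one _ _ _ _ (by omega) (by omega)]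
    rw [Nat.sub_self] at h2
    omega

/-- The difference of prefix counts just after an upper letter `a` is `1`,
just before it is `0`. -/
lemma tofP_pre (hP1 : ∀ x y, x + y < n → Dist3 (P 1 x y) (P 2 x y) (P 0 x y))
    (hP2 : ∀ x y, x + y + 1 < n → Dist3 (P 2 x y) (P 0 x (y + 1)) (P 1 (x + 1) y))
    (k i j a : ℕ) (hk : k + 1 ≤ n) (ha : 1 ≤ a ∧ a ≤ 3) (hi : 1 ≤ i ∧ i ≤ 3) (hj : j ≤ k)
    (h : TofP n P i (j + 1) (k + 1) = a) :
    preA (TofP n P) (k + 1) a i j = preA (TofP n P) k a i j ∧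
    preA (TofP n P) (k + 1) a i (j + 1) = preA (TofP n P) k a i j + 1 := by
  have hlast : preA (TofP n P) (k + 1) a i (j + 1) = preA (TofP n P) (k + 1) a i j + 1 := by
    have : i = 1 ∨ i = 2 ∨ i = 3 := by omega
    rcases this with rfl | rfl | rfl <;> simp [preA, cntA_succ, h, add_assoc]
  have h1 := tofP_block1 (P := P) k a hk k le_rfl
  have h2 := (tofP_block2 hP1 hP2 k a hk ha k le_rfl).2
  have e1 : cntA (TofP n P) (k + 1) a 1 (k + 1) = cntA (TofP n P) k a 1 k +
      if P 1 0 k = a then 1 else 0 := by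
    rw [cntA_succ _ _ _ 1, h1, TofP_one _ _ _ _ (by omega) (by omega)]
  suffices hs : preA (TofP n P) (k + 1) a i j = preA (TofP n P) k a i j by
    exact ⟨hs, by rw [hlast, hs]⟩
  have : i = 1 ∨ i = 2 ∨ i = 3 := by omega
  rcases this with rfl | rfl | rfl
  · simp [preA, tofP_block1 (P := P) k a hk j hj]
  · have h2' := (tofP_block2 hP1 hP2 k a hk ha j hj).1
    rw [TofP_two _ _ _ _ (by omega) (by omega), show k + 1 - (j + 1) = k - j by omega] at h
    have f := hP1 j (k - j) (by omega)
    unfold Dist3 at f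
    rw [if_neg (by omega : ¬ P 1 j (k - j) = a)] at h2'
    simp [preA]
    omega
  · have h3 := tofP_block3 (P := P) k a hk j hj
    rw [cntA_succ, h] at h3
    rw [Nat.sub_self] at h2
    simp [preA] at h3 ⊢
    omega

lemma tofP_isITA (hP1 : ∀ x y, x + y < n → Dist3 (P 1 x y) (P 2 x y) (P 0 x y))
    (hP2 : ∀ x y, x + y + 1 < n → Dist3 (P 2 x y) (P 0 x (y + 1)) (P 1 (x + 1) y)) :
    IsITA 3 n (TofP n P) := by
  have hval : ∀ i j k, 1 ≤ i → i ≤ 3 → 1 ≤ j → j ≤ k → k ≤ n →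
      TofP n P i j k ∈ Finset.Icc 1 3 := by
    intro i j k h1 h2 h3 h4 h5
    rw [Finset.mem_Icc]
    unfold TofP
    rw [if_pos ⟨h1, h2, h3, h4, h5⟩]
    have f1 := hP1 0 (j - 1) (by omega)
    have f2 := hP1 (j - 1) (k - j) (by omega)
    have f3 := hP1 (k - j) 0 (by omega)
    unfold Dist3 at *
    split_ifs <;> omega
  refine ⟨hval, ?_, ?_⟩
  · intro k _ hk a ha
    rw [card_row]
    exact tofP_total hP1 hP2 a (Finset.mem_Icc.1 ha) k hk
  · intro k hk1 hk i j i' j' hi1 hi3 hj1 hjk hi1' hi3' hj1' hjk' heq hlt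
    obtain ⟨k, rfl⟩ : ∃ m, k = m + 1 := ⟨k - 1, by omega⟩
    obtain ⟨j, rfl⟩ : ∃ m, j = m + 1 := ⟨j - 1, by omega⟩
    obtain ⟨j', rfl⟩ : ∃ m, j' = m + 1 := ⟨j' - 1, by omega⟩
    simp only [Nat.add_sub_cancel]
    obtain ⟨a, ha⟩ : ∃ a, TofP n P i (j + 1) (k + 1) = a := ⟨_, rfl⟩
    have haI := Finset.mem_Icc.1 (hval i (j + 1) (k + 1) hi1 hi3 hj1 hjk hk)
    rw [ha] at haI
    have p1 := (tofP_pre hP1 hP2 k i j a hk haI ⟨hi1, hi3⟩ (by omega) ha).2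
    have p2 := (tofP_pre hP1 hP2 k i' j' a hk haI ⟨hi1', hi3'⟩ (by omega) (by rw [← heq, ha])).1
    obtain ⟨e1, e2, e3, e4⟩ := posA_up (TofP n P) n k a i j hk (by omega)
    obtain ⟨e1', e2', e3', e4'⟩ := posA_up (TofP n P) n k a i' j' hk (by omega)
    by_contra hcon
    push Not at hcon
    have up : posA (TofP n P) n (k + 1) a (Hc n i (j + 1) (k + 1)) ≤
        posA (TofP n P) n (k + 1) a (Hc n i' (j' + 1) (k + 1) - 1) := by
      apply Finset.card_le_card
      intro p hp
      rw [Finset.mem_filter] at hp ⊢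
      exact ⟨hp.1, hp.2.1, by omega⟩
    have low : posA (TofP n P) n k a (Hc n i' (j' + 1) (k + 1) - 1) ≤
        posA (TofP n P) n k a (Hc n i (j + 1) (k + 1)) := by
      apply Finset.card_le_card
      rintro ⟨i'', j''⟩ hp
      rw [Finset.mem_filter] at hp ⊢
      refine ⟨hp.1, hp.2.1, ?_⟩
      rw [Finset.mem_product, Finset.mem_Icc, Finset.mem_Icc] at hp
      simp only at hp ⊢
      by_contra hgt
      have := hcon i'' j'' hp.1.1.1 hp.1.1.2 hp.1.2.1 hp.1.2.2 (by rw [hp.2.1, ha]) (by omega)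
      omega
    omega

end PtoT

/-- The set of arrays in the statement. -/
def TSet (n : ℕ) (lam : ℕ → ℕ → ℕ) : Set (ℕ → ℕ → ℕ → ℕ) :=
  {T | T ∈ ITAFull 3 n ∧ ∀ i j, 1 ≤ i → i ≤ 3 → 1 ≤ j → j ≤ n → T i j n = lam i j}

/-- The set of puzzles in the statement. -/
def QSet (n : ℕ) (lam : ℕ → ℕ → ℕ) : Set (ℕ → ℕ → ℕ → ℕ) :=
  {Q | Q ∈ Puzzle010Full n ∧ ∀ j, 1 ≤ j → j ≤ n →
        Q 1 0 (j - 1) = conv 1 (lam 1 j) ∧ Q 2 (j - 1) (n - j) = conv 2 (lam 2 j) ∧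
        Q 0 (n - j) 0 = conv 0 (lam 3 j)}

lemma tofP_maps (n : ℕ) (lam : ℕ → ℕ → ℕ) (P : ℕ → ℕ → ℕ → ℕ) (hP : P ∈ Puz123 n lam) :
    TofP n P ∈ TSet n lam := by
  obtain ⟨h1, h2, h3, h4⟩ := hP
  refine ⟨⟨tofP_isITA h1 h2, ?_⟩, ?_⟩
  · intro i j k h
    unfold TofP
    rw [if_neg h]
  · intro i j hi1 hi3 hj1 hjn
    unfold TofP
    rw [if_pos ⟨hi1, hi3, hj1, hjn, le_rfl⟩]
    obtain ⟨a, b, c⟩ := h4 j hj1 hjn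
    rw [a, b, c]
    have : i = 1 ∨ i = 2 ∨ i = 3 := by omega
    rcases this with rfl | rfl | rfl <;> simp

lemma tofP_inj (n : ℕ) (lam : ℕ → ℕ → ℕ) : Set.InjOn (TofP n) (Puz123 n lam) := by
  rintro P ⟨h1, h2, h3, h4⟩ P' ⟨h1', h2', h3', h4'⟩ heq
  have c : ∀ i j k, TofP n P i j k = TofP n P' i j k := by
    intro i j k; rw [heq]
  have e2 : ∀ x y, x + y < n → P 2 x y = P' 2 x y := by
    intro x y hxy
    have := c 2 (x + 1) (x + y + 1)
    rw [TofP_two _ _ _ _ (by omega) (by omega), TofP_two _ _ _ _ (by omega) (by omega)] at this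
    rwa [show x + y + 1 - (x + 1) = y by omega] at this
  have e0 : ∀ x y, x + y < n → P 1 x y = P' 1 x y → P 0 x y = P' 0 x y := by
    intro x y hxy h
    have f := h1 x y hxy
    have f' := h1' x y hxy
    have := e2 x y hxy
    unfold Dist3 at f f'
    omega
  have e1 : ∀ x y, x + y < n → P 1 x y = P' 1 x y := by
    intro x
    induction x with
    | zero =>
      intro y hy
      have := c 1 (y + 1) (y + 1)
      rwa [TofP_one _ _ _ _ (by omega) (by omega), TofP_one _ _ _ _ (by omega) (by omega)] at this
    | succ x ih =>
      intro y hy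
      have f := h2 x y (by omega)
      have f' := h2' x y (by omega)
      have g := e2 x y (by omega)
      have g' := e0 x (y + 1) (by omega) (ih (y + 1) (by omega))
      unfold Dist3 at f f'
      omega
  funext d x y
  by_cases h : d < 3 ∧ x + y < n
  · obtain ⟨hd, hxy⟩ := h
    have : d = 0 ∨ d = 1 ∨ d = 2 := by omega
    rcases this with rfl | rfl | rfl
    · exact e0 x y hxy (e1 x y hxy)
    · exact e1 x y hxy
    · exact e2 x y hxy
  · rw [h3 d x y h, h3' d x y h]

lemma ita_row1 (T : ℕ → ℕ → ℕ → ℕ) (n : ℕ) (hT : IsITA 3 n T) (j : ℕ) (hj : 1 ≤ j) :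
    ∀ d, j + d ≤ n → T 1 j (j + d) = T 1 j j := by
  intro d
  induction d with
  | zero => simp
  | succ d ih =>
    intro h
    rw [← ih (by omega)]
    exact (ita_block1 T n (j + d) hT (by omega) j (by omega)).2 hj

lemma ita_row3 (T : ℕ → ℕ → ℕ → ℕ) (n : ℕ) (hT : IsITA 3 n T) (e : ℕ) :
    ∀ j, j + e + 1 ≤ n → T 3 (j + 1) (j + e + 1) = T 3 1 (e + 1) := by
  intro j
  induction j with
  | zero => simp
  | succ j ih =>
    intro h
    rw [← ih (by omega)]
    have := (ita_block3 T n (j + e + 1) hT (by omega) (e + 1) j (by omega)).2 (by omega)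
    rw [← this]
    congr 1
    omega

lemma tofP_surj (n : ℕ) (lam : ℕ → ℕ → ℕ) (T : ℕ → ℕ → ℕ → ℕ) (hT : T ∈ TSet n lam) :
    ∃ P ∈ Puz123 n lam, TofP n P = T := by
  obtain ⟨⟨hI, h0⟩, hl⟩ := hT
  have hst : ∀ x y, ∃ p q, x + y + 1 ≤ n → p ∈ Finset.Icc 1 3 ∧ q ∈ Finset.Icc 1 3 ∧
      ∀ a ∈ Finset.Icc 1 3,
      preA T (x + y + 1) a 2 x = preA T (x + y) a 2 x + (if p = a then 1 else 0) ∧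
      preA T (x + y + 1) a 2 (x + 1) + (if q = a then 1 else 0) = preA T (x + y) a 2 x + 1 := by
    intro x y
    by_cases h : x + y + 1 ≤ n
    · obtain ⟨p, q, hpq⟩ := ita_state T n (x + y) hI h x (by omega)
      exact ⟨p, q, fun _ => hpq⟩
    · exact ⟨0, 0, fun h' => absurd h' h⟩
  choose p q hpq using hst
  have st : ∀ r a p, preA T r a 2 (p + 1) = preA T r a 2 p +
      if T 2 (p + 1) r = a then 1 else 0 := by
    intro r a p
    simp [preA, cntA_succ, add_assoc]
  have hp0 : ∀ y, y + 1 ≤ n → p 0 y = T 1 (y + 1) (y + 1) := by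
    intro y hy
    obtain ⟨hp, -, h⟩ := hpq 0 y (by omega)
    have h := (h _ hp).1
    have b := (ita_block1 T n y hI (by omega) y le_rfl).1 _ hp
    simp only [Nat.zero_add] at h
    by_contra hne
    simp [preA, cntA_succ, cntA_zero, b, Ne.symm hne] at h
  have hq0 : ∀ x, x + 1 ≤ n → q x 0 = T 3 1 (x + 1) := by
    intro x hx
    obtain ⟨-, hq, h⟩ := hpq x 0 (by omega)
    have h := (h _ hq).2
    have b := (ita_block3 T n x hI (by omega) x 0 (by omega)).1 _ hq
    simp only [Nat.add_zero] at h
    by_contra hne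
    simp [preA, cntA_succ, cntA_zero, Ne.symm hne] at h b
    omega
  let P : ℕ → ℕ → ℕ → ℕ := fun d x y => if d < 3 ∧ x + y < n then
    (if d = 1 then p x y else if d = 2 then T 2 (x + 1) (x + y + 1) else q x y) else 0
  have P1 : ∀ x y, x + y < n → P 1 x y = p x y := by
    intro x y h; simp [P, h]
  have P2 : ∀ x y, x + y < n → P 2 x y = T 2 (x + 1) (x + y + 1) := by
    intro x y h; simp [P, h]
  have P0 : ∀ x y, x + y < n → P 0 x y = q x y := by
    intro x y h; simp [P, h]
  refine ⟨P, ⟨?_, ?_, ?_, ?_⟩, ?_⟩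
  · intro x y hxy
    rw [P1 x y hxy, P2 x y hxy, P0 x y hxy]
    obtain ⟨hp, hq, h⟩ := hpq x y (by omega)
    have hu := hI.1 2 (x + 1) (x + y + 1) (by omega) (by omega) (by omega) (by omega) (by omega)
    obtain ⟨a1, -⟩ := h _ hu
    obtain ⟨b1, b2⟩ := h _ hp
    obtain ⟨c1, c2⟩ := h _ hq
    obtain ⟨d1, d2⟩ := h _ hu
    rw [st] at b2 c2 d2
    refine ⟨Finset.mem_Icc.1 hp, Finset.mem_Icc.1 hu, Finset.mem_Icc.1 hq, ?_, ?_, ?_⟩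
    · intro he
      simp [he] at d1 d2
      omega
    · intro he
      simp [he] at c1 c2
      omega
    · intro he
      simp [he] at c1 c2
      omega
  · intro x y hxy
    rw [P2 x y (by omega), P0 x (y + 1) (by omega), P1 (x + 1) y (by omega)]
    obtain ⟨-, hq, h⟩ := hpq x (y + 1) (by omega)
    obtain ⟨hp, -, h'⟩ := hpq (x + 1) y (by omega)
    have hu := hI.1 2 (x + 1) (x + y + 1) (by omega) (by omega) (by omega) (by omega) (by omega)
    rw [show x + (y + 1) = x + y + 1 by omega] at h
    rw [show x + 1 + y = x + y + 1 by omega] at h'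
    refine ⟨Finset.mem_Icc.1 hu, Finset.mem_Icc.1 hq, Finset.mem_Icc.1 hp, ?_, ?_, ?_⟩
    · intro he
      have c1 := (h _ hq).2
      have c2 := (h' _ hq).1
      rw [st (x + y + 1)] at c2
      simp [he] at c1 c2
      omega
    · intro he
      have c1 := (h _ hq).2
      have c2 := (h' _ hq).1
      rw [st (x + y + 1)] at c2
      simp [he] at c1 c2
      split_ifs at c2 <;> omega
    · intro he
      have c1 := (h _ hp).2
      have c2 := (h' _ hp).1
      rw [st (x + y + 1)] at c2
      simp [he] at c1 c2
      split_ifs at c1 <;> omega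
  · intro d x y h
    simp only [P]
    rw [if_neg h]
  · intro j hj1 hjn
    rw [P1 _ _ (by omega), P2 _ _ (by omega), P0 _ _ (by omega), hp0 _ (by omega),
      hq0 _ (by omega)]
    refine ⟨?_, ?_, ?_⟩
    · rw [← hl 1 j (by omega) (by omega) hj1 hjn, show j - 1 + 1 = j by omega]
      have := ita_row1 T n hI j hj1 (n - j) (by omega)
      rw [← this]
      congr 1
      omega
    · rw [← hl 2 j (by omega) (by omega) hj1 hjn]
      congr 1 <;> omega
    · rw [← hl 3 j (by omega) (by omega) hj1 hjn]
      have := ita_row3 T n hI (n - j) (j - 1) (by omega)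
      rw [← this]
      congr 1 <;> omega
  · funext i j k
    by_cases h : 1 ≤ i ∧ i ≤ 3 ∧ 1 ≤ j ∧ j ≤ k ∧ k ≤ n
    · obtain ⟨hi1, hi3, hj1, hjk, hk⟩ := h
      unfold TofP
      rw [if_pos ⟨hi1, hi3, hj1, hjk, hk⟩, P1 _ _ (by omega), P2 _ _ (by omega),
        P0 _ _ (by omega), hp0 _ (by omega), hq0 _ (by omega)]
      have : i = 1 ∨ i = 2 ∨ i = 3 := by omega
      rcases this with rfl | rfl | rfl
      · simp only [if_true]
        rw [show j - 1 + 1 = j by omega]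
        have := ita_row1 T n hI j hj1 (k - j) (by omega)
        rw [← this]
        congr 1
        omega
      · simp only [if_true, if_neg (by omega : ¬ (2 = 1))]
        congr 1 <;> omega
      · simp only [if_neg (by omega : ¬ (3 = 1)), if_neg (by omega : ¬ (3 = 2))]
        have := ita_row3 T n hI (k - j) (j - 1) (by omega)
        rw [← this]
        congr 1 <;> omega
    · rw [h0 i j k h]
      unfold TofP
      rw [if_neg h]

lemma ncard_TSet (n : ℕ) (lam : ℕ → ℕ → ℕ) : (TSet n lam).ncard = (Puz123 n lam).ncard := by
  rw [← (tofP_inj n lam).ncard_image]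
  congr 1
  ext T
  constructor
  · intro h
    obtain ⟨P, hP, h⟩ := tofP_surj n lam T h
    exact ⟨P, hP, h⟩
  · rintro ⟨P, hP, rfl⟩
    exact tofP_maps n lam P hP

/-- Inverse of the letterwise conversion. -/
def dconv (d l : ℕ) : ℕ :=
  if d = 1 then (if l = 0 then 2 else if l = 1 then 3 else 1)
  else if d = 2 then (if l = 0 then 1 else if l = 1 then 2 else 3)
  else (if l = 0 then 3 else if l = 1 then 1 else 2)

lemma dconv_conv (d l : ℕ) (hl : 1 ≤ l ∧ l ≤ 3) : dconv d (conv d l) = l := by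
  obtain ⟨h1, h3⟩ := hl
  unfold dconv conv
  interval_cases l <;> split_ifs <;> simp_all

lemma conv_dconv (d l : ℕ) (hl : l = 0 ∨ l = 1 ∨ l = 10) : conv d (dconv d l) = l := by
  unfold dconv conv
  rcases hl with rfl | rfl | rfl <;> split_ifs <;> simp_all

lemma dconv_mem (d l : ℕ) : 1 ≤ dconv d l ∧ dconv d l ≤ 3 := by
  unfold dconv
  split_ifs <;> simp

lemma conv_mem (d l : ℕ) : conv d l = 0 ∨ conv d l = 1 ∨ conv d l = 10 := by
  unfold conv
  split_ifs <;> simp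

/-- The `0/1/10` face condition (left, right, bottom). -/
def Face (l r b : ℕ) : Prop :=
  (l = r ∧ r = b) ∨ (l = 0 ∧ r = 10 ∧ b = 1) ∨ (l = 10 ∧ r = 1 ∧ b = 0) ∨
    (l = 1 ∧ r = 0 ∧ b = 10)

lemma face_conv (l r b : ℕ) (h : Dist3 l r b) : Face (conv 1 l) (conv 2 r) (conv 0 b) := by
  obtain ⟨⟨a1, a2⟩, ⟨b1, b2⟩, ⟨c1, c2⟩, d, e, f⟩ := h
  interval_cases l <;> interval_cases r <;> interval_cases b <;> simp_all [Face, conv]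

lemma face_dconv (l r b : ℕ) (hl : l = 0 ∨ l = 1 ∨ l = 10) (hr : r = 0 ∨ r = 1 ∨ r = 10)
    (hb : b = 0 ∨ b = 1 ∨ b = 10) (h : Face l r b) :
    Dist3 (dconv 1 l) (dconv 2 r) (dconv 0 b) := by
  rcases hl with rfl | rfl | rfl <;> rcases hr with rfl | rfl | rfl <;>
    rcases hb with rfl | rfl | rfl <;> simp_all [Face, Dist3, dconv]

lemma ncard_QSet (n : ℕ) (lam : ℕ → ℕ → ℕ)
    (hlam : ∀ i j, 1 ≤ i → i ≤ 3 → 1 ≤ j → j ≤ n → lam i j ∈ Finset.Icc 1 3) :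
    (QSet n lam).ncard = (Puz123 n lam).ncard := by
  have hrange : ∀ P ∈ Puz123 n lam, ∀ d x y, d < 3 → x + y < n → 1 ≤ P d x y ∧ P d x y ≤ 3 := by
    rintro P ⟨h1, -⟩ d x y hd hxy
    obtain ⟨a, b, c, -⟩ := h1 x y hxy
    have : d = 0 ∨ d = 1 ∨ d = 2 := by omega
    rcases this with rfl | rfl | rfl <;> assumption
  have hinj : Set.InjOn (QofP n) (Puz123 n lam) := by
    intro P hP P' hP' heq
    funext d x y
    by_cases h : d < 3 ∧ x + y < n
    · have e : QofP n P d x y = QofP n P' d x y := by rw [heq]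
      unfold QofP at e
      rw [if_pos h, if_pos h] at e
      rw [← dconv_conv d (P d x y) (hrange P hP d x y h.1 h.2), e,
        dconv_conv d (P' d x y) (hrange P' hP' d x y h.1 h.2)]
    · rw [hP.2.2.1 d x y h, hP'.2.2.1 d x y h]
  rw [← hinj.ncard_image]
  congr 1
  ext Q
  constructor
  · rintro ⟨⟨⟨q1, q2, q3⟩, q4⟩, q5⟩
    let P : ℕ → ℕ → ℕ → ℕ := fun d x y => if d < 3 ∧ x + y < n then dconv d (Q d x y) else 0
    have hP : ∀ d x y, d < 3 → x + y < n → P d x y = dconv d (Q d x y) := by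
      intro d x y h1 h2
      simp only [P]
      rw [if_pos ⟨h1, h2⟩]
    refine ⟨P, ⟨?_, ?_, ?_, ?_⟩, ?_⟩
    · intro x y h
      rw [hP 1 x y (by omega) h, hP 2 x y (by omega) h, hP 0 x y (by omega) h]
      exact face_dconv _ _ _ (q1 1 x y (by omega) h) (q1 2 x y (by omega) h)
        (q1 0 x y (by omega) h) (q2 x y h)
    · intro x y h
      rw [hP 2 x y (by omega) (by omega), hP 0 x (y + 1) (by omega) (by omega),
        hP 1 (x + 1) y (by omega) (by omega)]
      have := face_dconv (Q 1 (x + 1) y) (Q 2 x y) (Q 0 x (y + 1))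
        (q1 1 _ _ (by omega) (by omega)) (q1 2 _ _ (by omega) (by omega))
        (q1 0 _ _ (by omega) (by omega)) (by
          have := q3 x y h
          unfold Face
          omega)
      unfold Dist3 at *
      omega
    · intro d x y h
      simp only [P]
      rw [if_neg h]
    · intro j h1 hn
      rw [hP 1 _ _ (by omega) (by omega), hP 2 _ _ (by omega) (by omega),
        hP 0 _ _ (by omega) (by omega)]
      obtain ⟨a, b, c⟩ := q5 j h1 hn
      rw [a, b, c, dconv_conv _ _ (Finset.mem_Icc.1 (hlam 1 j (by omega) (by omega) h1 hn)),
        dconv_conv _ _ (Finset.mem_Icc.1 (hlam 2 j (by omega) (by omega) h1 hn)),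
        dconv_conv _ _ (Finset.mem_Icc.1 (hlam 3 j (by omega) (by omega) h1 hn))]
      exact ⟨rfl, rfl, rfl⟩
    · funext d x y
      unfold QofP
      split_ifs with h
      · rw [hP d x y h.1 h.2, conv_dconv d _ (q1 d x y h.1 h.2)]
      · rw [q4 d x y h]
  · rintro ⟨P, ⟨h1, h2, h3, h4⟩, rfl⟩
    have hQ : ∀ d x y, d < 3 → x + y < n → QofP n P d x y = conv d (P d x y) := by
      intro d x y h1 h2
      unfold QofP
      rw [if_pos ⟨h1, h2⟩]
    refine ⟨⟨⟨?_, ?_, ?_⟩, ?_⟩, ?_⟩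
    · intro d x y hd h
      rw [hQ d x y hd h]
      exact conv_mem _ _
    · intro x y h
      rw [hQ 1 x y (by omega) h, hQ 2 x y (by omega) h, hQ 0 x y (by omega) h]
      exact face_conv _ _ _ (h1 x y h)
    · intro x y h
      rw [hQ 2 x y (by omega) (by omega), hQ 0 x (y + 1) (by omega) (by omega),
        hQ 1 (x + 1) y (by omega) (by omega)]
      have f := face_conv (P 1 (x + 1) y) (P 2 x y) (P 0 x (y + 1)) (by
        have := h2 x y h
        unfold Dist3 at *
        omega)
      unfold Face at f
      omega
    · intro d x y h
      unfold QofP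
      rw [if_neg h]
    · intro j hj hn
      rw [hQ 1 _ _ (by omega) (by omega), hQ 2 _ _ (by omega) (by omega),
        hQ 0 _ _ (by omega) (by omega)]
      obtain ⟨a, b, c⟩ := h4 j hj hn
      rw [a, b, c]
      exact ⟨rfl, rfl, rfl⟩

/-- For every `n ≥ 1` and `λ ∈ ({1,2,3}^n)^3`, the number of interlacing triangular
arrays of rank `3` and height `n` with top row `λ` equals the number of
`0/1/10`-puzzles on `Δ_n` with boundary conditions `∂(λ)`. -/
theorem card_ITA_eq_card_puzzle010 (n : ℕ) (hn : 1 ≤ n) (lam : ℕ → ℕ → ℕ)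
    (hlam : ∀ i j, 1 ≤ i → i ≤ 3 → 1 ≤ j → j ≤ n → lam i j ∈ Finset.Icc 1 3) :
    {T | T ∈ ITAFull 3 n ∧ ∀ i j, 1 ≤ i → i ≤ 3 → 1 ≤ j → j ≤ n →
        T i j n = lam i j}.ncard
    = {Q | Q ∈ Puzzle010Full n ∧ ∀ j, 1 ≤ j → j ≤ n →
        Q 1 0 (j - 1) = conv 1 (lam 1 j) ∧ Q 2 (j - 1) (n - j) = conv 2 (lam 2 j) ∧
        Q 0 (n - j) 0 = conv 0 (lam 3 j)}.ncard := by
  exact (ncard_TSet n lam).trans (ncard_QSet n lam hlam).symm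
end

section
/- Fix m ≥ 3, integers 0 = d_0 ≤ d_1 ≤ ⋯ ≤ d_{m−1} ≤ d_m = n, and for i = 1,…,m a string λ^{(i)} ∈ {1,…,m}^n containing exactly d_{m−i} copies of the letter m−i, exactly d_{m−i+1} − d_{m−i} copies of the letter m, and exactly n − d_{m−i+1} copies of the letter m−i+1. Then |𝒯_{m,n}(λ^{(1)},…,λ^{(m)})| = Σ_μ |𝒯^{{m−2,m−1,m}}_{3,n}(λ^{(1)},λ^{(2)},μ)| · |𝒯^{{1,…,m}∖{m−1}}_{m−1,n}(μ†,λ^{(3)},…,λ^{(m)})|, where the sum runs over strings μ ∈ {m−2,m}^n containing exactly n − d_{m−2} copies of m−2 and d_{m−2} copies of m, and μ† is the string obtained from μ by reversing it and exchanging the letters m−2 and m. Moreover the map sending T = (T^{(1)},…,T^{(m)}) to the pair ((T^{(1)},T^{(2)},R^{(3)}), ((R^{(3)})†,T^{(3)},…,T^{(m)})) described by the splitting construction realizes this as an explicit bijection. -/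
/-- `T` is an interlacing triangular array of rank `m` and height `n` with entries in
the alphabet `S` (a finite set of naturals of cardinality `m`). -/
def IsITAS (S : Finset ℕ) (m n : ℕ) (T : ℕ → ℕ → ℕ → ℕ) : Prop :=
  (∀ i j k, 1 ≤ i → i ≤ m → 1 ≤ j → j ≤ k → k ≤ n → T i j k ∈ S) ∧
  (∀ k, 1 ≤ k → k ≤ n → ∀ a ∈ S,
      ((Finset.Icc 1 m ×ˢ Finset.Icc 1 k).filter (fun p => T p.1 p.2 k = a)).card = k) ∧
  (∀ k, 1 ≤ k → k ≤ n → ∀ i j i' j',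
      1 ≤ i → i ≤ m → 1 ≤ j → j ≤ k → 1 ≤ i' → i' ≤ m → 1 ≤ j' → j' ≤ k →
      T i j k = T i' j' k → Hc n i j k < Hc n i' j' k →
      ∃ i'' j'', 1 ≤ i'' ∧ i'' ≤ m ∧ 1 ≤ j'' ∧ j'' ≤ k - 1 ∧
        T i'' j'' (k - 1) = T i j k ∧
        Hc n i j k < Hc n i'' j'' (k - 1) ∧ Hc n i'' j'' (k - 1) < Hc n i' j' k)

/-- The set of interlacing triangular arrays with alphabet `S`, rank `m`, height `n`
and top row `lam` (i.e. `T i j n = lam i j`), normalized to `0` off-support. -/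
def ITASet (S : Finset ℕ) (m n : ℕ) (lam : ℕ → ℕ → ℕ) : Set (ℕ → ℕ → ℕ → ℕ) :=
  {T | IsITAS S m n T ∧
      (∀ i j, 1 ≤ i → i ≤ m → 1 ≤ j → j ≤ n → T i j n = lam i j) ∧
      ∀ i j k, ¬(1 ≤ i ∧ i ≤ m ∧ 1 ≤ j ∧ j ≤ k ∧ k ≤ n) → T i j k = 0}

/-- The multiset of letters of the string `(f 1, …, f n)`. -/
def strMS (n : ℕ) (f : ℕ → ℕ) : Multiset ℕ := (Finset.Icc 1 n).val.map f

/-- The letter swap `m-2 ↔ m` used to dualize two-letter strings over `{m-2, m}`. -/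
def swapLet (m v : ℕ) : ℕ := if v = m - 2 then m else if v = m then m - 2 else v

/-- The splitting relation: `(R, S)` is obtained from `T` by the splitting
construction, i.e. `R = (T^(1), T^(2), R^(3))` where `R^(3)` satisfies the defining
shift recursion `R^(3)_(j,k) = R^(3)_(j-1,k-1)`, and
`S = ((R^(3))†, T^(3), …, T^(m))`, where `(R^(3))†` is the dual triangle
(rows reversed, letters `m-2` and `m` exchanged). -/
def SplitRel (m n : ℕ) (T R S : ℕ → ℕ → ℕ → ℕ) : Prop :=
  (∀ j k, 1 ≤ j → j ≤ k → k ≤ n → R 1 j k = T 1 j k ∧ R 2 j k = T 2 j k) ∧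
  (∀ j k, 2 ≤ j → j ≤ k → k ≤ n → R 3 j k = R 3 (j - 1) (k - 1)) ∧
  (∀ j k, 1 ≤ j → j ≤ k → k ≤ n → S 1 j k = swapLet m (R 3 (k + 1 - j) k)) ∧
  (∀ i j k, 2 ≤ i → i ≤ m - 1 → 1 ≤ j → j ≤ k → k ≤ n → S i j k = T (i + 1) j k)

/-- The codomain of the splitting map: pairs `(R, S)` where, for some two-letter
string `μ` of type `(m-2)^(n - d_(m-2)) m^(d_(m-2))`, `R` is an interlacing array with
alphabet `{m-2, m-1, m}`, rank `3` and top row `(λ^(1), λ^(2), μ)`, and `S` is an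
interlacing array with alphabet `{1,…,m} ∖ {m-1}`, rank `m-1` and top row
`(μ†, λ^(3), …, λ^(m))`. -/
def SplitTarget (m n : ℕ) (d : ℕ → ℕ) (lam : ℕ → ℕ → ℕ) :
    Set ((ℕ → ℕ → ℕ → ℕ) × (ℕ → ℕ → ℕ → ℕ)) :=
  {RS | ∃ mu : ℕ → ℕ,
      strMS n mu =
        Multiset.replicate (n - d (m - 2)) (m - 2) + Multiset.replicate (d (m - 2)) m ∧
      RS.1 ∈ ITASet (Finset.Icc (m - 2) m) 3 n
          (fun i j => if i = 1 then lam 1 j else if i = 2 then lam 2 j else mu j) ∧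
      RS.2 ∈ ITASet ((Finset.Icc 1 m).erase (m - 1)) (m - 1) n
          (fun i j => if i = 1 then swapLet m (mu (n + 1 - j)) else lam (i + 1) j)}

open Finset in
/-- number of letters `a` among the first `j` entries of row `k` of triangle `i` -/
def cnt (T : ℕ → ℕ → ℕ → ℕ) (a k i j : ℕ) : ℕ :=
  ((Icc 1 j).filter (fun j' => T i j' k = a)).card

/-- number of letters `a` in row `k` of the triangles before `i` -/
def Wc (T : ℕ → ℕ → ℕ → ℕ) (a k i : ℕ) : ℕ := ∑ i' ∈ Finset.Ico 1 i, cnt T a k i' k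

theorem cnt_zero (T : ℕ → ℕ → ℕ → ℕ) (a k i : ℕ) : cnt T a k i 0 = 0 := by simp [cnt]

theorem cnt_succ (T : ℕ → ℕ → ℕ → ℕ) (a k i j : ℕ) :
    cnt T a k i (j + 1) = cnt T a k i j + if T i (j + 1) k = a then 1 else 0 := by
  unfold cnt
  rw [← Finset.insert_Icc_right_eq_Icc_add_one (by omega), Finset.filter_insert]
  split_ifs with h
  · rw [Finset.card_insert_of_notMem (by simp)]
  · simp

theorem cnt_congr {T T' : ℕ → ℕ → ℕ → ℕ} {a a' k k' i i' j : ℕ}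
    (h : ∀ j', 1 ≤ j' → j' ≤ j → (T i j' k = a ↔ T' i' j' k' = a')) :
    cnt T a k i j = cnt T' a' k' i' j := by
  unfold cnt
  congr 1
  apply Finset.filter_congr
  intro x hx
  rw [Finset.mem_Icc] at hx
  exact h x hx.1 hx.2

theorem cnt_eq_zero {T : ℕ → ℕ → ℕ → ℕ} {a k i j : ℕ} (h : cnt T a k i j = 0) :
    ∀ j', 1 ≤ j' → j' ≤ j → T i j' k ≠ a := by
  intro j' h1 h2 h3
  unfold cnt at h
  rw [Finset.card_eq_zero, Finset.filter_eq_empty_iff] at h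
  exact h (Finset.mem_Icc.2 ⟨h1, h2⟩) h3

theorem cnt_zero_of {T : ℕ → ℕ → ℕ → ℕ} {a k i j : ℕ} 
    (h : ∀ j', 1 ≤ j' → j' ≤ j → T i j' k ≠ a) : cnt T a k i j = 0 := by
  unfold cnt
  rw [Finset.card_eq_zero, Finset.filter_eq_empty_iff]
  intro x hx
  rw [Finset.mem_Icc] at hx
  exact h x hx.1 hx.2

theorem Wc_one (T : ℕ → ℕ → ℕ → ℕ) (a k : ℕ) : Wc T a k 1 = 0 := by simp [Wc]

theorem Wc_succ (T : ℕ → ℕ → ℕ → ℕ) (a k i : ℕ) (hi : 1 ≤ i) :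
    Wc T a k (i + 1) = Wc T a k i + cnt T a k i k := by
  unfold Wc
  rw [Finset.sum_Ico_succ_top hi]

theorem Wc_zero (T : ℕ → ℕ → ℕ → ℕ) (a i : ℕ) : Wc T a 0 i = 0 := by
  simp [Wc, cnt_zero]

theorem Wc_mono (T : ℕ → ℕ → ℕ → ℕ) (a k : ℕ) {i i' : ℕ} (h : i ≤ i') :
    Wc T a k i ≤ Wc T a k i' := by
  unfold Wc
  apply Finset.sum_le_sum_of_subset
  exact Finset.Ico_subset_Ico le_rfl h

open Finset in
/-- positions of letters `a` in row `k` weakly before `(i,j)` -/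
def Up (T : ℕ → ℕ → ℕ → ℕ) (m a k i j : ℕ) : Finset (ℕ × ℕ) :=
  (Icc 1 m ×ˢ Icc 1 k).filter (fun p => T p.1 p.2 k = a ∧ (p.1 < i ∨ p.1 = i ∧ p.2 ≤ j))

theorem mem_Up {T : ℕ → ℕ → ℕ → ℕ} {m a k i j : ℕ} {p : ℕ × ℕ} :
    p ∈ Up T m a k i j ↔ (1 ≤ p.1 ∧ p.1 ≤ m ∧ 1 ≤ p.2 ∧ p.2 ≤ k) ∧ T p.1 p.2 k = a ∧
      (p.1 < i ∨ p.1 = i ∧ p.2 ≤ j) := by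
  simp only [Up, Finset.mem_filter, Finset.mem_product, Finset.mem_Icc, and_assoc]

theorem Up_card_top (T : ℕ → ℕ → ℕ → ℕ) (m a k : ℕ) :
    ((Finset.Icc 1 m ×ˢ Finset.Icc 1 k).filter (fun p => T p.1 p.2 k = a)).card
      = Wc T a k (m + 1) := by
  rw [Finset.card_filter, Finset.sum_product, Wc]
  apply Finset.sum_congr
  · ext; simp
  · intro i _
    rw [cnt, Finset.card_filter]

theorem Up_card (T : ℕ → ℕ → ℕ → ℕ) (m a k i j : ℕ) (hi : 1 ≤ i) (him : i ≤ m) (hj : j ≤ k) :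
    (Up T m a k i j).card = Wc T a k i + cnt T a k i j := by
  rw [Up, Finset.card_filter, Finset.sum_product, Wc]
  have h1 : ∀ x ∈ Finset.Icc 1 m, (∑ y ∈ Finset.Icc 1 k,
      if T x y k = a ∧ (x < i ∨ x = i ∧ y ≤ j) then 1 else 0) =
      (if x < i then cnt T a k x k else 0) + (if x = i then cnt T a k i j else 0) := by
    intro x hx
    rcases lt_trichotomy x i with h | h | h
    · rw [if_pos h, if_neg (by omega), cnt, Finset.card_filter]
      simp [h]
    · subst h
      rw [if_neg (by omega), if_pos rfl, cnt, ← Finset.card_filter, zero_add]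
      congr 1
      ext y
      simp
      omega
    · rw [if_neg (by omega), if_neg (by omega)]
      apply Finset.sum_eq_zero
      intro y _
      rw [if_neg (by omega)]
  rw [Finset.sum_congr rfl h1, Finset.sum_add_distrib]
  congr 1
  · rw [← Finset.sum_filter]
    apply Finset.sum_congr _ (fun _ _ => rfl)
    ext; simp; omega
  · rw [Finset.sum_ite_eq' (Finset.Icc 1 m) i, if_pos (by simp; omega)]

/-- Counting reformulation of interlacing arrays. -/
structure Good (S : Finset ℕ) (m n : ℕ) (T : ℕ → ℕ → ℕ → ℕ) : Prop where
  mem : ∀ i j k, 1 ≤ i → i ≤ m → 1 ≤ j → j ≤ k → k ≤ n → T i j k ∈ S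
  tot : ∀ k, k ≤ n → ∀ a ∈ S, Wc T a k (m + 1) = k
  lo : ∀ k, k < n → ∀ a ∈ S, ∀ i, 1 ≤ i → i ≤ m → ∀ j, j ≤ k →
    Wc T a k i + cnt T a k i j ≤ Wc T a (k + 1) i + cnt T a (k + 1) i j
  hi : ∀ k, k < n → ∀ a ∈ S, ∀ i, 1 ≤ i → i ≤ m → ∀ j, j ≤ k →
    Wc T a (k + 1) i + cnt T a (k + 1) i (j + 1) ≤ Wc T a k i + cnt T a k i j + 1

theorem Hc_lt {n i j k i' j' k' : ℕ} (hj : 1 ≤ j) (hjk : j ≤ k) (hk : k ≤ n)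
    (hj' : 1 ≤ j') (hjk' : j' ≤ k') (hk' : k' ≤ n) :
    Hc n i j k < Hc n i' j' k' ↔ i < i' ∨ (i = i' ∧ 2 * j + k' < 2 * j' + k) := by
  unfold Hc
  rcases lt_trichotomy i i' with h | h | h
  · have : (i : ℤ) * n + n ≤ i' * n := by
      have : (i : ℤ) + 1 ≤ i' := by exact_mod_cast h
      nlinarith
    constructor
    · intro _; exact Or.inl h
    · intro _; omega
  · subst h; omega
  · have : (i' : ℤ) * n + n ≤ i * n := by
      have : (i' : ℤ) + 1 ≤ i := by exact_mod_cast h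
      nlinarith
    omega

theorem interl_card (n k k' : ℕ) (P Q : Finset (ℕ × ℕ)) (hk : k ≤ n)
    (hP : ∀ p ∈ P, 1 ≤ p.2 ∧ p.2 ≤ k)
    (h : ∀ p ∈ P, ∀ p' ∈ P, Hc n p.1 p.2 k < Hc n p'.1 p'.2 k →
      ∃ q ∈ Q, Hc n p.1 p.2 k < Hc n q.1 q.2 k' ∧ Hc n q.1 q.2 k' < Hc n p'.1 p'.2 k) :
    P.card ≤ Q.card + 1 := by
  have hc : (P.image (fun p => Hc n p.1 p.2 k)).card = P.card := by
    apply Finset.card_image_of_injOn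
    intro p hp q hq hpq
    have hp1 := hP p hp
    have hq1 := hP q hq
    have h1 := (Hc_lt (i := p.1) (i' := q.1) hp1.1 hp1.2 hk hq1.1 hq1.2 hk).not
    have h2 := (Hc_lt (i := q.1) (i' := p.1) hq1.1 hq1.2 hk hp1.1 hp1.2 hk).not
    simp only at hpq
    have h1 := h1.1 (by rw [hpq]; exact lt_irrefl _)
    have h2 := h2.1 (by rw [hpq]; exact lt_irrefl _)
    ext <;> omega
  rw [← hc]
  refine le_trans (Finset.card_le_of_interleaved (t := Q.image (fun p => Hc n p.1 p.2 k')) ?_)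
    (Nat.add_le_add_right Finset.card_image_le 1)
  intro x hx y hy hxy _
  simp only [Finset.mem_image] at hx hy
  obtain ⟨p, hp, rfl⟩ := hx
  obtain ⟨p', hp', rfl⟩ := hy
  obtain ⟨q, hq, h1, h2⟩ := h p hp p' hp' hxy
  exact ⟨_, Finset.mem_image_of_mem _ hq, h1, h2⟩

theorem Good_of {S : Finset ℕ} {m n : ℕ} {T : ℕ → ℕ → ℕ → ℕ} (h : IsITAS S m n T) :
    Good S m n T := by
  obtain ⟨h1, h2, h3⟩ := h
  have tot : ∀ k, k ≤ n → ∀ a ∈ S, Wc T a k (m + 1) = k := by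
    intro k hk a ha
    rcases Nat.eq_zero_or_pos k with rfl | hk0
    · rw [Wc_zero]
    · rw [← Up_card_top, h2 k hk0 hk a ha]
  refine ⟨h1, tot, ?_, ?_⟩
  · intro k hk a ha i hi him j hj
    set F : ℕ → Finset (ℕ × ℕ) := fun k => 
      ((Finset.Icc 1 m ×ˢ Finset.Icc 1 k).filter (fun p => T p.1 p.2 k = a)) with hF
    have hsub : ∀ k, Up T m a k i j ⊆ F k := by
      intro k p hp
      rw [mem_Up] at hp
      simp only [hF, Finset.mem_filter, Finset.mem_product, Finset.mem_Icc]
      tauto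
    have hmem : ∀ k, ∀ p, p ∈ F k \ Up T m a k i j ↔ 
      ((1 ≤ p.1 ∧ p.1 ≤ m ∧ 1 ≤ p.2 ∧ p.2 ≤ k) ∧ T p.1 p.2 k = a ∧
      ¬ (p.1 < i ∨ p.1 = i ∧ p.2 ≤ j)) := by
      intro k p
      rw [Finset.mem_sdiff, mem_Up]
      simp only [hF, Finset.mem_filter, Finset.mem_product, Finset.mem_Icc]
      tauto
    have hFc : ∀ k ≤ n, (F k).card = k := by
      intro k hk; rw [hF]; simp only; rw [Up_card_top, tot k hk a ha]
    have hcard : (F (k + 1) \ Up T m a (k + 1) i j).card ≤ (F k \ Up T m a k i j).card + 1 := by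
      apply interl_card n (k + 1) k _ _ hk
      · intro p hp; rw [hmem] at hp; exact hp.1.2.2
      · intro p hp p' hp' hlt
        rw [hmem] at hp hp'
        obtain ⟨i2, j2, q1, q2, q3, q4, q5, q6, q7⟩ := h3 (k + 1) (by omega) hk p.1 p.2 p'.1 p'.2
          hp.1.1 hp.1.2.1 hp.1.2.2.1 hp.1.2.2.2 hp'.1.1 hp'.1.2.1 hp'.1.2.2.1 hp'.1.2.2.2
          (by rw [hp.2.1, hp'.2.1]) hlt
        simp only [Nat.add_sub_cancel] at q4 q5 q6 q7
        refine ⟨(i2, j2), ?_, q6, q7⟩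
        rw [hmem]
        rw [Hc_lt hp.1.2.2.1 hp.1.2.2.2 hk q3 q4 hk.le] at q6
        refine ⟨⟨q1, q2, q3, q4⟩, by rw [← hp.2.1]; exact q5, ?_⟩
        have := hp.2.2
        simp only
        omega
    rw [Finset.card_sdiff_of_subset (hsub _), Finset.card_sdiff_of_subset (hsub _), 
      hFc _ hk, hFc _ hk.le, Up_card _ _ _ _ _ _ hi him (by omega), 
      Up_card _ _ _ _ _ _ hi him (by omega)] at hcard
    have hle := Finset.card_le_card (hsub (k + 1))
    have hle' := Finset.card_le_card (hsub k)
    rw [hFc _ (by omega), Up_card _ _ _ _ _ _ hi him (by omega)] at hle hle'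
    omega
  · intro k hk a ha i hi him j hj
    rw [← Up_card T m _ _ _ _ hi him (by omega), ← Up_card T m _ _ _ _ hi him (by omega)]
    apply interl_card n (k + 1) k _ _ hk
    · intro p hp; rw [mem_Up] at hp; exact hp.1.2.2
    · intro p hp p' hp' hlt
      rw [mem_Up] at hp hp'
      obtain ⟨i2, j2, q1, q2, q3, q4, q5, q6, q7⟩ := h3 (k + 1) (by omega) hk p.1 p.2 p'.1 p'.2
        hp.1.1 hp.1.2.1 hp.1.2.2.1 hp.1.2.2.2 hp'.1.1 hp'.1.2.1 hp'.1.2.2.1 hp'.1.2.2.2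
        (by rw [hp.2.1, hp'.2.1]) hlt
      simp only [Nat.add_sub_cancel] at q4 q5 q6 q7
      refine ⟨(i2, j2), ?_, q6, q7⟩
      rw [mem_Up]
      rw [Hc_lt q3 q4 hk.le hp'.1.2.2.1 hp'.1.2.2.2 hk] at q7
      refine ⟨⟨q1, q2, q3, q4⟩, by rw [← hp.2.1]; exact q5, ?_⟩
      have := hp'.2.2
      simp only
      omega

theorem Good.isITAS {S : Finset ℕ} {m n : ℕ} {T : ℕ → ℕ → ℕ → ℕ} (h : Good S m n T) :
    IsITAS S m n T := by
  refine ⟨h.mem, ?_, ?_⟩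
  · intro k _ hk a ha
    rw [Up_card_top, h.tot k hk a ha]
  · intro k hk0 hk i j i' j' hi him hj hjk hi' him' hj' hjk' hT hlt
    obtain ⟨k, rfl⟩ : ∃ l, k = l + 1 := ⟨k - 1, by omega⟩
    obtain ⟨j, rfl⟩ : ∃ l, j = l + 1 := ⟨j - 1, by omega⟩
    obtain ⟨j', rfl⟩ : ∃ l, j' = l + 1 := ⟨j' - 1, by omega⟩
    simp only [Nat.add_sub_cancel]
    set a := T i (j + 1) (k + 1) with ha
    have haS : a ∈ S := h.mem _ _ _ hi him hj hjk hk
    by_contra hcon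
    have b1 := h.lo k hk a haS i hi him j (by omega)
    have b2 := h.hi k hk a haS i' hi' him' j' (by omega)
    rw [← Up_card T m _ _ _ _ hi him (by omega), ← Up_card T m _ _ _ _ hi him (by omega)] at b1
    rw [← Up_card T m _ _ _ _ hi' him' (by omega), 
      ← Up_card T m _ _ _ _ hi' him' (by omega)] at b2
    have hlt' := hlt
    rw [Hc_lt hj hjk hk hj' hjk' hk] at hlt'
    have c1 : Up T m a k i' j' ⊆ Up T m a k i j := by
      intro q hq
      rw [mem_Up] at hq ⊢
      refine ⟨hq.1, hq.2.1, ?_⟩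
      by_contra hq2
      apply hcon
      refine ⟨q.1, q.2, hq.1.1, hq.1.2.1, hq.1.2.2.1, hq.1.2.2.2, hq.2.1, ?_, ?_⟩
      · rw [Hc_lt hj hjk hk hq.1.2.2.1 hq.1.2.2.2 (by omega)]
        omega
      · rw [Hc_lt hq.1.2.2.1 hq.1.2.2.2 (by omega) hj' hjk' hk]
        omega
    have c2 : insert (i', j' + 1) (insert (i, j + 1) (Up T m a (k + 1) i j)) ⊆
        Up T m a (k + 1) i' (j' + 1) := by
      intro q hq
      simp only [Finset.mem_insert, mem_Up] at hq ⊢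
      rcases hq with rfl | rfl | hq
      · exact ⟨⟨hi', him', hj', hjk'⟩, hT.symm, by simp⟩
      · refine ⟨⟨hi, him, hj, hjk⟩, rfl, ?_⟩
        simp only
        omega
      · refine ⟨hq.1, hq.2.1, ?_⟩
        omega
    have d1 := Finset.card_le_card c1
    have d2 := Finset.card_le_card c2
    rw [Finset.card_insert_of_notMem, Finset.card_insert_of_notMem] at d2
    · omega
    · rw [mem_Up]; simp
    · rw [Finset.mem_insert, mem_Up]; simp only [Prod.mk.injEq]; omega

theorem Wc_congr {T T' : ℕ → ℕ → ℕ → ℕ} {a k i : ℕ}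
    (h : ∀ i' j', 1 ≤ i' → i' < i → 1 ≤ j' → j' ≤ k → T i' j' k = T' i' j' k) :
    Wc T a k i = Wc T' a k i := by
  unfold Wc
  apply Finset.sum_congr rfl
  intro x hx
  rw [Finset.mem_Ico] at hx
  apply cnt_congr
  intro j' h1 h2
  rw [h x j' hx.1 hx.2 h1 h2]

theorem Wc_shift {T S : ℕ → ℕ → ℕ → ℕ} {a k : ℕ} (h0 : Wc S a k 2 = Wc T a k 3) (i : ℕ) :
    (∀ i' j', 2 ≤ i' → i' < i + 2 → 1 ≤ j' → j' ≤ k → S i' j' k = T (i' + 1) j' k) →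
    Wc S a k (i + 2) = Wc T a k (i + 3) := by
  induction i with
  | zero => intro _; exact h0
  | succ i ih =>
    intro h
    have h1 := Wc_succ S a k (i + 2) (by omega)
    have h2 := Wc_succ T a k (i + 3) (by omega)
    have h3 := ih (fun i' j' g1 g2 => h i' j' g1 (by omega))
    have h4 : cnt S a k (i + 2) k = cnt T a k (i + 3) k := by
      apply cnt_congr
      intro j' g1 g2
      rw [h (i + 2) j' (by omega) (by omega) g1 g2]
    have e1 : i + 1 + 2 = i + 2 + 1 := by omega
    have e2 : i + 1 + 3 = i + 3 + 1 := by omega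
    rw [e1, e2]
    omega

theorem cnt2 {T : ℕ → ℕ → ℕ → ℕ} {a b k i j : ℕ} (hab : a ≠ b)
    (h : ∀ j', 1 ≤ j' → j' ≤ j → T i j' k = a ∨ T i j' k = b) :
    cnt T a k i j + cnt T b k i j = j := by
  induction j with
  | zero => simp [cnt_zero]
  | succ j ih =>
    have h1 := ih (fun j' g1 g2 => h j' g1 (by omega))
    have h2 := h (j + 1) (by omega) le_rfl
    rw [cnt_succ, cnt_succ]
    split_ifs <;> omega

theorem cnt3 {T : ℕ → ℕ → ℕ → ℕ} {a b c k i j : ℕ} (hab : a ≠ b) (hac : a ≠ c) (hbc : b ≠ c)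
    (h : ∀ j', 1 ≤ j' → j' ≤ j → T i j' k = a ∨ T i j' k = b ∨ T i j' k = c) :
    cnt T a k i j + cnt T b k i j + cnt T c k i j = j := by
  induction j with
  | zero => simp [cnt_zero]
  | succ j ih =>
    have h1 := ih (fun j' g1 g2 => h j' g1 (by omega))
    have h2 := h (j + 1) (by omega) le_rfl
    rw [cnt_succ, cnt_succ, cnt_succ]
    split_ifs <;> omega

theorem Good.step {S : Finset ℕ} {m n : ℕ} {T : ℕ → ℕ → ℕ → ℕ} (h : Good S m n T)
    {k a i : ℕ} (hk : k < n) (ha : a ∈ S) (hi : 1 ≤ i) (him : i ≤ m) :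
    Wc T a k i ≤ Wc T a (k + 1) i ∧ Wc T a (k + 1) i ≤ Wc T a k i + 1 := by
  have h1 := h.lo k hk a ha i hi him 0 (by omega)
  have h2 := h.hi k hk a ha i hi him 0 (by omega)
  simp only [cnt_zero] at h1 h2
  omega

theorem Good.sup_lo {S : Finset ℕ} {m n : ℕ} {T : ℕ → ℕ → ℕ → ℕ} (h : Good S m n T)
    {a i : ℕ} (ha : a ∈ S) (hi : 1 ≤ i) (him : i ≤ m) (h0 : Wc T a n i = 0) :
    ∀ k, k ≤ n → Wc T a k i = 0 := by
  have : ∀ l k, k + l = n → Wc T a k i = 0 := by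
    intro l
    induction l with
    | zero => intro k hk; obtain rfl : k = n := by omega
              exact h0
    | succ l ih =>
      intro k hk
      have h1 := ih (k + 1) (by omega)
      have h2 := h.step (k := k) (by omega) ha hi him
      omega
  intro k hk
  exact this (n - k) k (by omega)

theorem Good.sup_hi {S : Finset ℕ} {m n : ℕ} {T : ℕ → ℕ → ℕ → ℕ} (h : Good S m n T)
    {a i : ℕ} (ha : a ∈ S) (hi : 1 ≤ i) (him : i ≤ m) (h0 : Wc T a n i = n) :
    ∀ k, k ≤ n → Wc T a k i = k := by
  have : ∀ l k, k + l = n → Wc T a k i = k := by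
    intro l
    induction l with
    | zero => intro k hk; obtain rfl : k = n := by omega
              exact h0
    | succ l ih =>
      intro k hk
      have h1 := ih (k + 1) (by omega)
      have h2 := h.step (k := k) (by omega) ha hi him
      have h3 := Wc_mono T a k (show i ≤ m + 1 by omega)
      rw [h.tot k (by omega) a ha] at h3
      omega
  intro k hk
  exact this (n - k) k (by omega)

theorem count_strMS (n a : ℕ) (f : ℕ → ℕ) (T : ℕ → ℕ → ℕ → ℕ) (i : ℕ)
    (h : ∀ j, 1 ≤ j → j ≤ n → T i j n = f j) :
    Multiset.count a (strMS n f) = cnt T a n i n := by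
  unfold strMS cnt
  rw [Multiset.count_map, ← Finset.filter_val, Finset.card_val]
  congr 1
  apply Finset.filter_congr
  intro x hx
  rw [Finset.mem_Icc] at hx
  rw [h x hx.1 hx.2]
  exact eq_comm

theorem cnt_shift {R : ℕ → ℕ → ℕ → ℕ} {a k j : ℕ} (hj : j ≤ k)
    (h : ∀ j, 1 ≤ j → j ≤ k → R 3 (j + 1) (k + 1) = R 3 j k) :
    cnt R a (k + 1) 3 (j + 1) = cnt R a k 3 j + if R 3 1 (k + 1) = a then 1 else 0 := by
  induction j with
  | zero => rw [cnt_succ, cnt_zero, cnt_zero]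
  | succ j ih =>
    have h1 := ih (by omega)
    rw [cnt_succ, h1, cnt_succ R a k 3 j, h (j + 1) (by omega) hj]
    omega

theorem star {S : Finset ℕ} {n : ℕ} {R : ℕ → ℕ → ℕ → ℕ} (hR : Good S 3 n R) {k a : ℕ}
    (hk : k < n) (ha : a ∈ S)
    (h : ∀ j, 1 ≤ j → j ≤ k → R 3 (j + 1) (k + 1) = R 3 j k) :
    Wc R a (k + 1) 3 + (if R 3 1 (k + 1) = a then 1 else 0) = Wc R a k 3 + 1 := by
  have h1 := hR.tot k (by omega) a ha
  have h2 := hR.tot (k + 1) (by omega) a ha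
  rw [Wc_succ _ _ _ _ (by omega)] at h1 h2
  rw [cnt_shift le_rfl h] at h2
  omega

theorem shiftR {m n : ℕ} (hm : 3 ≤ m) {R : ℕ → ℕ → ℕ → ℕ}
    (hR : Good (Finset.Icc (m - 2) m) 3 n R)
    (ht : ∀ j, 1 ≤ j → j ≤ n → R 3 j n = m - 2 ∨ R 3 j n = m) :
    (∀ k, k ≤ n → Wc R (m - 1) k 3 = k) ∧
    (∀ j k, 1 ≤ j → j ≤ k → k ≤ n → R 3 j k = m - 2 ∨ R 3 j k = m) ∧
    (∀ k, k < n → ∀ j, 1 ≤ j → j ≤ k → R 3 (j + 1) (k + 1) = R 3 j k) := by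
  have m1 : m - 1 ∈ Finset.Icc (m - 2) m := by rw [Finset.mem_Icc]; omega
  have m2 : m - 2 ∈ Finset.Icc (m - 2) m := by rw [Finset.mem_Icc]; omega
  have m0 : m ∈ Finset.Icc (m - 2) m := by rw [Finset.mem_Icc]; omega
  have hW : ∀ k, k ≤ n → Wc R (m - 1) k 3 = k := by
    apply hR.sup_hi m1 (by omega) le_rfl
    have h1 := hR.tot n le_rfl (m - 1) m1
    rw [Wc_succ _ _ _ _ (by omega), cnt_zero_of] at h1
    · exact h1
    · intro j h1 h2
      have := ht j h1 h2
      omega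
  have h2 : ∀ j k, 1 ≤ j → j ≤ k → k ≤ n → R 3 j k = m - 2 ∨ R 3 j k = m := by
    intro j k hj hjk hk
    have h1 := hR.tot k hk (m - 1) m1
    rw [Wc_succ _ _ _ _ (by omega), hW k hk] at h1
    have h2 := cnt_eq_zero (show cnt R (m - 1) k 3 k = 0 by omega) j hj hjk
    have h3 := hR.mem 3 j k (by omega) le_rfl hj hjk hk
    rw [Finset.mem_Icc] at h3
    omega
  refine ⟨hW, h2, ?_⟩
  intro k hk
  have E : ∀ j, j ≤ k → ∀ a, (a = m - 2 ∨ a = m) →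
     Wc R a (k + 1) 3 + cnt R a (k + 1) 3 (j + 1) = Wc R a k 3 + cnt R a k 3 j + 1 := by
    intro j hj
    have a1 := hR.hi k hk (m - 2) m2 3 (by omega) le_rfl j hj
    have a2 := hR.hi k hk m m0 3 (by omega) le_rfl j hj
    have t1 := hR.tot k hk.le (m - 2) m2
    have t2 := hR.tot k hk.le m m0
    have t3 := hR.tot (k + 1) hk (m - 2) m2
    have t4 := hR.tot (k + 1) hk m m0
    rw [Wc_succ _ _ _ _ (by omega)] at t1 t2 t3 t4
    have hne : m - 2 ≠ m := by omega
    have c1 := cnt2 (T := R) (k := k) (i := 3) (j := k) hne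
      (fun j' g1 g2 => h2 j' k g1 (by omega) (by omega))
    have c2 := cnt2 (T := R) (k := k) (i := 3) (j := j) hne
      (fun j' g1 g2 => h2 j' k g1 (by omega) (by omega))
    have c3 := cnt2 (T := R) (k := k + 1) (i := 3) (j := k + 1) hne
      (fun j' g1 g2 => h2 j' (k + 1) g1 (by omega) (by omega))
    have c4 := cnt2 (T := R) (k := k + 1) (i := 3) (j := j + 1) hne
      (fun j' g1 g2 => h2 j' (k + 1) g1 (by omega) (by omega))
    rintro a (rfl | rfl) <;> omega
  intro j hj hjk
  have e1 := E j hjk _ (h2 j k hj hjk hk.le)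
  obtain ⟨j, rfl⟩ : ∃ l, j = l + 1 := ⟨j - 1, by omega⟩
  have e2 := E j (by omega) _ (h2 (j + 1) k hj hjk hk.le)
  rw [cnt_succ, cnt_succ R _ k, if_pos rfl] at e1
  by_contra hcon
  rw [if_neg hcon] at e1
  omega

theorem shiftS {m n : ℕ} (hm : 3 ≤ m) {S : ℕ → ℕ → ℕ → ℕ}
    (hS : Good ((Finset.Icc 1 m).erase (m - 1)) (m - 1) n S)
    (ht : ∀ j, 1 ≤ j → j ≤ n → S 1 j n = m - 2 ∨ S 1 j n = m) :
    (∀ j k, 1 ≤ j → j ≤ k → k ≤ n → S 1 j k = m - 2 ∨ S 1 j k = m) ∧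
    (∀ k, k < n → ∀ j, 1 ≤ j → j ≤ k → S 1 j (k + 1) = S 1 j k) := by
  have m2 : m - 2 ∈ (Finset.Icc 1 m).erase (m - 1) := by
    rw [Finset.mem_erase, Finset.mem_Icc]; omega
  have m0 : m ∈ (Finset.Icc 1 m).erase (m - 1) := by 
    rw [Finset.mem_erase, Finset.mem_Icc]; omega
  have h2 : ∀ j k, 1 ≤ j → j ≤ k → k ≤ n → S 1 j k = m - 2 ∨ S 1 j k = m := by
    intro j k hj hjk hk
    by_contra hcon
    have hmem := hS.mem 1 j k le_rfl (by omega) hj hjk hk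
    have h0 : Wc S (S 1 j k) n 2 = 0 := by
      rw [Wc_succ _ _ _ _ le_rfl, Wc_one, cnt_zero_of]
      intro j' h1 h2
      have := ht j' h1 h2
      omega
    have h1 := hS.sup_lo hmem (by omega) (by omega) h0 k hk
    rw [Wc_succ _ _ _ _ le_rfl, Wc_one] at h1
    exact cnt_eq_zero (show cnt S (S 1 j k) k 1 k = 0 by omega) j hj hjk rfl
  refine ⟨h2, ?_⟩
  intro k hk
  have E : ∀ j, j ≤ k → ∀ a, (a = m - 2 ∨ a = m) → cnt S a (k + 1) 1 j = cnt S a k 1 j := by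
    intro j hj
    have a1 := hS.lo k hk (m - 2) m2 1 (by omega) (by omega) j hj
    have a2 := hS.lo k hk m m0 1 (by omega) (by omega) j hj
    simp only [Wc_one] at a1 a2
    have hne : m - 2 ≠ m := by omega
    have c2 := cnt2 (T := S) (k := k) (i := 1) (j := j) hne
      (fun j' g1 g2 => h2 j' k g1 (by omega) (by omega))
    have c4 := cnt2 (T := S) (k := k + 1) (i := 1) (j := j) hne
      (fun j' g1 g2 => h2 j' (k + 1) g1 (by omega) (by omega))
    rintro a (rfl | rfl) <;> omega
  intro j hj hjk
  have e1 := E j hjk _ (h2 j k hj hjk hk.le)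
  obtain ⟨j, rfl⟩ : ∃ l, j = l + 1 := ⟨j - 1, by omega⟩
  have e2 := E j (by omega) _ (h2 (j + 1) k hj hjk hk.le)
  rw [cnt_succ, cnt_succ S _ k, if_pos rfl] at e1
  by_contra hcon
  rw [if_neg hcon] at e1
  omega

theorem R_top {n : ℕ} {R : ℕ → ℕ → ℕ → ℕ}
    (h : ∀ k, k < n → ∀ j, 1 ≤ j → j ≤ k → R 3 (j + 1) (k + 1) = R 3 j k) :
    ∀ l j k, k + l = n → 1 ≤ j → j ≤ k → R 3 j k = R 3 (j + l) n := by
  intro l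
  induction l with
  | zero => intro j k hk _ _; obtain rfl : k = n := by omega
            rfl
  | succ l ih =>
    intro j k hk hj hjk
    rw [← h k (by omega) j hj hjk, ih (j + 1) (k + 1) (by omega) (by omega) (by omega)]
    congr 1
    omega

theorem S_top {n : ℕ} {S : ℕ → ℕ → ℕ → ℕ}
    (h : ∀ k, k < n → ∀ j, 1 ≤ j → j ≤ k → S 1 j (k + 1) = S 1 j k) :
    ∀ l j k, k + l = n → 1 ≤ j → j ≤ k → S 1 j k = S 1 j n := by
  intro l
  induction l with
  | zero => intro j k hk _ _; obtain rfl : k = n := by omega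
            rfl
  | succ l ih =>
    intro j k hk hj hjk
    rw [← h k (by omega) j hj hjk, ih j (k + 1) (by omega) (by omega) (by omega)]

theorem swapLet_mem {m v : ℕ} (h : v = m - 2 ∨ v = m) : 
    swapLet m v = m - 2 ∨ swapLet m v = m := by
  unfold swapLet
  split_ifs <;> omega

/-- assembling the original array from the two pieces -/
theorem good_glue {m n : ℕ} (hm : 3 ≤ m) {T R S : ℕ → ℕ → ℕ → ℕ}
    (hR : Good (Finset.Icc (m - 2) m) 3 n R)
    (hS : Good ((Finset.Icc 1 m).erase (m - 1)) (m - 1) n S)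
    (hRt : ∀ j, 1 ≤ j → j ≤ n → R 3 j n = m - 2 ∨ R 3 j n = m)
    (hSt : ∀ j, 1 ≤ j → j ≤ n → S 1 j n = swapLet m (R 3 (n + 1 - j) n))
    (hT1 : ∀ i j k, 1 ≤ i → i ≤ 2 → 1 ≤ j → j ≤ k → k ≤ n → T i j k = R i j k)
    (hT2 : ∀ i j k, 2 ≤ i → i ≤ m - 1 → 1 ≤ j → j ≤ k → k ≤ n → S i j k = T (i + 1) j k) :
    Good (Finset.Icc 1 m) m n T ∧ SplitRel m n T R S := by
  obtain ⟨r1, r2, r3⟩ := shiftR hm hR hRt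
  have hSt' : ∀ j, 1 ≤ j → j ≤ n → S 1 j n = m - 2 ∨ S 1 j n = m := by
    intro j h1 h2
    rw [hSt j h1 h2]
    exact swapLet_mem (hRt _ (by omega) (by omega))
  obtain ⟨s2, s3⟩ := shiftS hm hS hSt'
  have dual : ∀ j k, 1 ≤ j → j ≤ k → k ≤ n → S 1 j k = swapLet m (R 3 (k + 1 - j) k) := by
    intro j k hj hjk hk
    rw [S_top s3 (n - k) j k (by omega) hj hjk, hSt j hj (by omega),
      R_top r3 (n - k) (k + 1 - j) k (by omega) (by omega) (by omega)]
    congr 2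
    omega
  refine ⟨?_, ?_, ?_, dual, hT2⟩
  rotate_left
  · intro j k hj hjk hk
    exact ⟨(hT1 1 j k (by omega) (by omega) hj hjk hk).symm,
      (hT1 2 j k (by omega) (by omega) hj hjk hk).symm⟩
  · intro j k hj hjk hk
    have := r3 (k - 1) (by omega) (j - 1) (by omega) (by omega)
    rwa [Nat.sub_add_cancel (by omega), Nat.sub_add_cancel (by omega)] at this
  have memA : ∀ a, a ∈ Finset.Icc 1 m → a ≠ m - 1 → a ∈ (Finset.Icc 1 m).erase (m - 1) := by
    intro a h1 h2; exact Finset.mem_erase.2 ⟨h2, h1⟩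
  have WTR : ∀ a k i, k ≤ n → i ≤ 3 → Wc T a k i = Wc R a k i := by
    intro a k i hk hi
    apply Wc_congr
    intro i' j' h1 h2 h3 h4
    exact hT1 i' j' k h1 (by omega) h3 h4 hk
  have cTR : ∀ a k i j, k ≤ n → 1 ≤ i → i ≤ 2 → j ≤ k → cnt T a k i j = cnt R a k i j := by
    intro a k i j hk hi hi2 hj
    apply cnt_congr
    intro j' h3 h4
    rw [hT1 i j' k hi hi2 h3 (by omega) hk]
  have cTS : ∀ a k i j, k ≤ n → 2 ≤ i → i ≤ m - 1 → j ≤ k → 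
      cnt T a k (i + 1) j = cnt S a k i j := by
    intro a k i j hk hi hi2 hj
    apply cnt_congr
    intro j' h3 h4
    rw [hT2 i j' k hi hi2 h3 (by omega) hk]
  have Rlow : ∀ a k i j, a < m - 2 → k ≤ n → 1 ≤ i → i ≤ 3 → j ≤ k → cnt R a k i j = 0 := by
    intro a k i j ha hk hi hi3 hj
    apply cnt_zero_of
    intro j' h1 h2 h3
    have := hR.mem i j' k hi hi3 h1 (by omega) hk
    rw [Finset.mem_Icc] at this
    omega
  have WRlow : ∀ a k, a < m - 2 → k ≤ n → ∀ i, i ≤ 3 → Wc R a k i = 0 := by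
    intro a k ha hk i hi
    unfold Wc
    apply Finset.sum_eq_zero
    intro x hx
    rw [Finset.mem_Ico] at hx
    exact Rlow a k x k ha hk hx.1 (by omega) le_rfl
  have Snot : ∀ k i j, k ≤ n → 1 ≤ i → i ≤ m - 1 → j ≤ k → cnt S (m - 1) k i j = 0 := by
    intro k i j hk hi hi3 hj
    apply cnt_zero_of
    intro j' h1 h2 h3
    have := hS.mem i j' k hi hi3 h1 (by omega) hk
    rw [Finset.mem_erase] at this
    omega
  have W3 : ∀ a ∈ Finset.Icc 1 m, a ≠ m - 1 → ∀ k, k ≤ n → Wc S a k 2 = Wc T a k 3 := by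
    intro a ha hne k hk
    rw [WTR a k 3 hk le_rfl, Wc_succ _ _ _ _ le_rfl, Wc_one, zero_add]
    rw [Finset.mem_Icc] at ha
    by_cases hlow : a < m - 2
    · rw [WRlow a k hlow hk 3 le_rfl]
      apply cnt_zero_of
      intro j h1 h2
      have := s2 j k h1 h2 hk
      omega
    · induction k with
      | zero => rw [Wc_zero, cnt_zero]
      | succ k ih =>
        have h1 := ih (by omega)
        have h2 := star hR (k := k) (a := a) hk (by rw [Finset.mem_Icc]; omega) (r3 k hk)
        have h3 := r2 1 (k + 1) le_rfl (by omega) hk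
        have h4 := dual (k + 1) (k + 1) (by omega) le_rfl hk
        have h5 : cnt S a (k + 1) 1 k = cnt S a k 1 k := by
          apply cnt_congr
          intro j g1 g2
          rw [s3 k hk j g1 g2]
        rw [cnt_succ, h5, h4]
        rw [Nat.add_sub_cancel_left]
        unfold swapLet
        split_ifs at h2 ⊢ <;> omega
  have WTS : ∀ a ∈ Finset.Icc 1 m, a ≠ m - 1 → ∀ k, k ≤ n → ∀ i, i + 2 ≤ m →
      Wc S a k (i + 2) = Wc T a k (i + 3) := by
    intro a ha hne k hk i hi
    apply Wc_shift (W3 a ha hne k hk)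
    intro i' j' h1 h2 h3 h4
    exact hT2 i' j' k h1 (by omega) h3 h4 hk
  have W1 : ∀ k, k ≤ n → ∀ i, i + 2 ≤ m → Wc T (m - 1) k (i + 3) = k := by
    intro k hk i
    induction i with
    | zero => intro _; rw [WTR _ _ _ hk (by omega), r1 k hk]
    | succ i ih =>
      intro hi
      have h1 := Wc_succ T (m - 1) k (i + 3) (by omega)
      rw [cTS _ _ (i + 2) _ hk (by omega) (by omega) le_rfl, 
        Snot _ _ _ hk (by omega) (by omega) le_rfl, ih (by omega)] at h1
      exact h1
  constructor
  · intro i j k hi him hj hjk hk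
    by_cases h : i ≤ 2
    · rw [hT1 i j k hi h hj hjk hk]
      have := hR.mem i j k hi (by omega) hj hjk hk
      rw [Finset.mem_Icc] at this ⊢
      omega
    · obtain ⟨i, rfl⟩ : ∃ l, i = l + 1 := ⟨i - 1, by omega⟩
      rw [← hT2 i j k (by omega) (by omega) hj hjk hk]
      exact Finset.mem_of_mem_erase (hS.mem i j k (by omega) (by omega) hj hjk hk)
  · intro k hk a ha
    obtain ⟨i, rfl⟩ : ∃ l, m = l + 2 := ⟨m - 2, by omega⟩
    by_cases hne : a = i + 2 - 1
    · subst hne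
      exact W1 k hk i le_rfl
    · rw [← WTS a ha hne k hk i le_rfl]
      exact hS.tot k hk a (memA a ha hne)
  · intro k hk a ha i hi him j hj
    by_cases h : i ≤ 2
    · rw [WTR _ _ _ hk.le (by omega), WTR _ _ _ hk (by omega), cTR _ _ _ _ hk.le hi h hj,
        cTR _ _ _ _ hk hi h (by omega)]
      by_cases hlow : a < m - 2
      · rw [WRlow a k hlow hk.le i (by omega), Rlow a k i j hlow hk.le hi (by omega) hj]
        omega
      · rw [Finset.mem_Icc] at ha
        exact hR.lo k hk a (by rw [Finset.mem_Icc]; omega) i hi (by omega) j hj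
    · obtain ⟨i, rfl⟩ : ∃ l, i = l + 3 := ⟨i - 3, by omega⟩
      rw [cTS _ _ (i + 2) _ hk.le (by omega) (by omega) (by omega),
        cTS _ _ (i + 2) _ hk (by omega) (by omega) (by omega)]
      by_cases hne : a = m - 1
      · subst hne
        rw [W1 k hk.le i (by omega), W1 (k + 1) hk i (by omega),
          Snot _ _ _ hk.le (by omega) (by omega) hj]
        omega
      · rw [← WTS a ha hne k hk.le i (by omega), ← WTS a ha hne (k + 1) hk i (by omega)]
        exact hS.lo k hk a (memA a ha hne) (i + 2) (by omega) (by omega) j hj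
  · intro k hk a ha i hi him j hj
    by_cases h : i ≤ 2
    · rw [WTR _ _ _ hk.le (by omega), WTR _ _ _ hk (by omega), cTR _ _ _ _ hk.le hi h hj,
        cTR _ _ _ _ hk hi h (by omega)]
      by_cases hlow : a < m - 2
      · rw [WRlow a (k + 1) hlow hk i (by omega), 
          Rlow a (k + 1) i (j + 1) hlow hk hi (by omega) (by omega)]
        omega
      · rw [Finset.mem_Icc] at ha
        exact hR.hi k hk a (by rw [Finset.mem_Icc]; omega) i hi (by omega) j hj
    · obtain ⟨i, rfl⟩ : ∃ l, i = l + 3 := ⟨i - 3, by omega⟩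
      rw [cTS _ _ (i + 2) _ hk.le (by omega) (by omega) (by omega),
        cTS _ _ (i + 2) _ hk (by omega) (by omega) (by omega)]
      by_cases hne : a = m - 1
      · subst hne
        rw [W1 k hk.le i (by omega), W1 (k + 1) hk i (by omega),
          Snot _ _ _ hk (by omega) (by omega) (by omega)]
        omega
      · rw [← WTS a ha hne k hk.le i (by omega), ← WTS a ha hne (k + 1) hk i (by omega)]
        exact hS.hi k hk a (memA a ha hne) (i + 2) (by omega) (by omega) j hj

/-- splitting an array into two pieces -/
theorem good_split {m n : ℕ} (hm : 3 ≤ m) {T R S : ℕ → ℕ → ℕ → ℕ} {b : ℕ → ℕ}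
    (hT : Good (Finset.Icc 1 m) m n T)
    (hmid : ∀ k, k ≤ n → Wc T (m - 1) k 3 = k)
    (hlow : ∀ a, 1 ≤ a → a < m - 2 → ∀ k, k ≤ n → Wc T a k 3 = 0)
    (hb2 : ∀ k, b k = m - 2 ∨ b k = m)
    (hb : ∀ k, k < n → ∀ a, m - 2 ≤ a → a ≤ m → 
      Wc T a (k + 1) 3 + (if b (k + 1) = a then 1 else 0) = Wc T a k 3 + 1)
    (hR1 : ∀ i j k, 1 ≤ i → i ≤ 2 → 1 ≤ j → j ≤ k → k ≤ n → R i j k = T i j k)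
    (hR3 : ∀ j k, 1 ≤ j → j ≤ k → k ≤ n → R 3 j k = b (k + 1 - j))
    (hS1 : ∀ j k, 1 ≤ j → j ≤ k → k ≤ n → S 1 j k = swapLet m (b j))
    (hS2 : ∀ i j k, 2 ≤ i → i ≤ m - 1 → 1 ≤ j → j ≤ k → k ≤ n → S i j k = T (i + 1) j k) :
    Good (Finset.Icc (m - 2) m) 3 n R ∧ Good ((Finset.Icc 1 m).erase (m - 1)) (m - 1) n S := by
  have WRT : ∀ a k i, k ≤ n → i ≤ 3 → Wc R a k i = Wc T a k i := by
    intro a k i hk hi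
    apply Wc_congr
    intro i' j' h1 h2 h3 h4
    exact hR1 i' j' k h1 (by omega) h3 h4 hk
  have cRT : ∀ a k i j, k ≤ n → 1 ≤ i → i ≤ 2 → j ≤ k → cnt R a k i j = cnt T a k i j := by
    intro a k i j hk hi hi2 hj
    apply cnt_congr
    intro j' h3 h4
    rw [hR1 i j' k hi hi2 h3 (by omega) hk]
  have cTS : ∀ a k i j, k ≤ n → 2 ≤ i → i ≤ m - 1 → j ≤ k → 
      cnt S a k i j = cnt T a k (i + 1) j := by
    intro a k i j hk hi hi2 hj
    apply cnt_congr
    intro j' h3 h4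
    rw [hS2 i j' k hi hi2 h3 (by omega) hk]
  have rsh : ∀ k, k < n → ∀ j, 1 ≤ j → j ≤ k → R 3 (j + 1) (k + 1) = R 3 j k := by
    intro k hk j hj hjk
    rw [hR3 _ _ (by omega) (by omega) hk, hR3 _ _ hj hjk hk.le]
    congr 1
    omega
  have r31 : ∀ k, k < n → R 3 1 (k + 1) = b (k + 1) := by
    intro k hk
    rw [hR3 _ _ (by omega) (by omega) hk]
    congr 1
  have key : ∀ k, k < n → ∀ a, m - 2 ≤ a → a ≤ m → ∀ j, j ≤ k →
      Wc R a (k + 1) 3 + cnt R a (k + 1) 3 (j + 1) = Wc R a k 3 + cnt R a k 3 j + 1 := by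
    intro k hk a h1 h2 j hj
    rw [WRT _ (k + 1) _ hk le_rfl, WRT _ _ _ hk.le le_rfl, cnt_shift hj (rsh k hk), r31 k hk]
    have := hb k hk a h1 h2
    omega
  have s1k : ∀ k, k < n → ∀ a j, j ≤ k → cnt S a (k + 1) 1 j = cnt S a k 1 j := by
    intro k hk a j hj
    apply cnt_congr
    intro j' h1 h2
    rw [hS1 _ _ h1 (by omega) hk, hS1 _ _ h1 (by omega) hk.le]
  have W3 : ∀ a ∈ Finset.Icc 1 m, a ≠ m - 1 → ∀ k, k ≤ n → Wc S a k 2 = Wc T a k 3 := by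
    intro a ha hne k hk
    rw [Wc_succ _ _ _ _ le_rfl, Wc_one, zero_add]
    rw [Finset.mem_Icc] at ha
    by_cases hlo : a < m - 2
    · rw [hlow a ha.1 hlo k hk]
      apply cnt_zero_of
      intro j h1 h2
      have := swapLet_mem (hb2 j)
      rw [hS1 j k h1 h2 hk]
      omega
    · induction k with
      | zero => rw [Wc_zero, cnt_zero]
      | succ k ih =>
        have h1 := ih (by omega)
        have h2 := hb k hk a (by omega) (by omega)
        have h3 := hb2 (k + 1)
        rw [cnt_succ, s1k k hk a k le_rfl, hS1 _ _ (by omega) le_rfl hk]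
        unfold swapLet
        split_ifs at h2 ⊢ <;> omega
  have WTS : ∀ a ∈ Finset.Icc 1 m, a ≠ m - 1 → ∀ k, k ≤ n → ∀ i, i + 2 ≤ m →
      Wc S a k (i + 2) = Wc T a k (i + 3) := by
    intro a ha hne k hk i hi
    apply Wc_shift (W3 a ha hne k hk)
    intro i' j' h1 h2 h3 h4
    exact hS2 i' j' k h1 (by omega) h3 h4 hk
  constructor
  · constructor
    · intro i j k hi him hj hjk hk
      by_cases h : i ≤ 2
      · rw [hR1 i j k hi h hj hjk hk]
        have h1 := hT.mem i j k hi (by omega) hj hjk hk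
        rw [Finset.mem_Icc] at h1 ⊢
        refine ⟨?_, h1.2⟩
        by_contra hcon
        have h2 := hlow _ h1.1 (by omega) k hk
        have h3 := Wc_mono T (T i j k) k (show i + 1 ≤ 3 by omega)
        rw [Wc_succ _ _ _ _ hi] at h3
        exact cnt_eq_zero (show cnt T (T i j k) k i k = 0 by omega) j hj hjk rfl
      · obtain rfl : i = 3 := by omega
        rw [hR3 j k hj hjk hk, Finset.mem_Icc]
        have := hb2 (k + 1 - j)
        omega
    · intro k hk a ha
      rw [Finset.mem_Icc] at ha
      rw [Wc_succ _ _ _ _ (by omega)]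
      induction k with
      | zero => rw [Wc_zero, cnt_zero]
      | succ k ih =>
        have := key k hk a ha.1 ha.2 k le_rfl
        have := ih (by omega)
        omega
    · intro k hk a ha i hi him j hj
      by_cases h : i ≤ 2
      · rw [Finset.mem_Icc] at ha
        rw [WRT _ _ _ hk.le (by omega), WRT _ _ _ hk (by omega), cRT _ _ _ _ hk.le hi h hj,
          cRT _ _ _ _ hk hi h (by omega)]
        exact hT.lo k hk a (by rw [Finset.mem_Icc]; omega) i hi (by omega) j hj
      · obtain rfl : i = 3 := by omega
        rw [Finset.mem_Icc] at ha
        have h1 := key k hk a ha.1 ha.2 j hj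
        rw [cnt_succ] at h1
        split_ifs at h1 <;> omega
    · intro k hk a ha i hi him j hj
      by_cases h : i ≤ 2
      · rw [Finset.mem_Icc] at ha
        rw [WRT _ _ _ hk.le (by omega), WRT _ _ _ hk (by omega), cRT _ _ _ _ hk.le hi h hj,
          cRT _ _ _ _ hk hi h (by omega)]
        exact hT.hi k hk a (by rw [Finset.mem_Icc]; omega) i hi (by omega) j hj
      · obtain rfl : i = 3 := by omega
        rw [Finset.mem_Icc] at ha
        exact (key k hk a ha.1 ha.2 j hj).le
  · constructor
    · intro i j k hi him hj hjk hk
      rw [Finset.mem_erase, Finset.mem_Icc]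
      by_cases h : i = 1
      · subst h
        rw [hS1 j k hj hjk hk]
        have := swapLet_mem (hb2 j)
        omega
      · rw [hS2 i j k (by omega) him hj hjk hk]
        have h1 := hT.mem (i + 1) j k (by omega) (by omega) hj hjk hk
        rw [Finset.mem_Icc] at h1
        refine ⟨?_, h1⟩
        have h2 := Wc_mono T (m - 1) k (show 3 ≤ i + 1 by omega)
        have h3 := Wc_succ T (m - 1) k (i + 1) (by omega)
        have h4 := Wc_mono T (m - 1) k (show i + 1 + 1 ≤ m + 1 by omega)
        rw [hT.tot k hk (m - 1) (by rw [Finset.mem_Icc]; omega)] at h4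
        rw [hmid k hk] at h2
        exact cnt_eq_zero (show cnt T (m - 1) k (i + 1) k = 0 by omega) j hj hjk
    · intro k hk a ha
      rw [Finset.mem_erase] at ha
      obtain ⟨i, rfl⟩ : ∃ l, m = l + 2 := ⟨m - 2, by omega⟩
      exact (WTS a ha.2 ha.1 k hk i le_rfl).trans (hT.tot k hk a ha.2)
    · intro k hk a ha i hi him j hj
      rw [Finset.mem_erase] at ha
      by_cases h : i = 1
      · subst h
        rw [Wc_one, Wc_one, s1k k hk a j hj]
      · obtain ⟨i, rfl⟩ : ∃ l, i = l + 2 := ⟨i - 2, by omega⟩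
        rw [cTS _ _ _ _ hk.le (by omega) him hj, cTS _ _ _ _ hk (by omega) him (by omega),
          WTS a ha.2 ha.1 k hk.le i (by omega), WTS a ha.2 ha.1 (k + 1) hk i (by omega)]
        exact hT.lo k hk a ha.2 (i + 3) (by omega) (by omega) j hj
    · intro k hk a ha i hi him j hj
      rw [Finset.mem_erase] at ha
      by_cases h : i = 1
      · subst h
        rw [Wc_one, Wc_one, cnt_succ, s1k k hk a j hj]
        split_ifs <;> omega
      · obtain ⟨i, rfl⟩ : ∃ l, i = l + 2 := ⟨i - 2, by omega⟩
        rw [cTS _ _ _ _ hk.le (by omega) him hj, cTS _ _ _ _ hk (by omega) him (by omega),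
          WTS a ha.2 ha.1 k hk.le i (by omega), WTS a ha.2 ha.1 (k + 1) hk i (by omega)]
        exact hT.hi k hk a ha.2 (i + 3) (by omega) (by omega) j hj

theorem split_exists (m n : ℕ) (hm : 3 ≤ m) (d : ℕ → ℕ)
    (hdm : d m = n) (hmono : ∀ i, i < m → d i ≤ d (i + 1))
    (lam : ℕ → ℕ → ℕ)
    (hlam : ∀ i, 1 ≤ i → i ≤ m →
        strMS n (lam i) =
          Multiset.replicate (d (m - i)) (m - i) +
          Multiset.replicate (d (m - i + 1) - d (m - i)) m +
          Multiset.replicate (n - d (m - i + 1)) (m - i + 1))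
    (T : ℕ → ℕ → ℕ → ℕ) (hTm : T ∈ ITASet (Finset.Icc 1 m) m n lam) :
    ∃ RS : (ℕ → ℕ → ℕ → ℕ) × (ℕ → ℕ → ℕ → ℕ),
          RS ∈ SplitTarget m n d lam ∧ SplitRel m n T RS.1 RS.2 := by
  obtain ⟨hI, htop, hoff⟩ := hTm
  have hT := Good_of hI
  have ctop : ∀ a, Wc T a n 3 =
      Multiset.count a (Multiset.replicate (d (m - 1)) (m - 1) +
          Multiset.replicate (n - d (m - 1)) m) + 
      Multiset.count a (Multiset.replicate (d (m - 2)) (m - 2) +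
          Multiset.replicate (d (m - 1) - d (m - 2)) m +
          Multiset.replicate (n - d (m - 1)) (m - 1)) := by
    intro a
    have e1 := hlam 1 le_rfl (by omega)
    have e2 := hlam 2 (by omega) (by omega)
    rw [show m - 1 + 1 = m by omega, hdm, Nat.sub_self, Multiset.replicate_zero, add_zero] at e1
    rw [show m - 2 + 1 = m - 1 by omega] at e2
    rw [← e1, ← e2, Wc_succ _ _ _ _ (by omega), Wc_succ _ _ _ _ (by omega), Wc_one, zero_add,
      count_strMS n a _ T 1 (fun j h1 h2 => htop 1 j le_rfl (by omega) h1 h2),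
      count_strMS n a _ T 2 (fun j h1 h2 => htop 2 j (by omega) (by omega) h1 h2)]
  have hd1 : d (m - 1) ≤ n := by
    have := hmono (m - 1) (by omega)
    rwa [show m - 1 + 1 = m by omega, hdm] at this
  have hd2 : d (m - 2) ≤ d (m - 1) := by
    have := hmono (m - 2) (by omega)
    rwa [show m - 2 + 1 = m - 1 by omega] at this
  simp only [Multiset.count_add, Multiset.count_replicate] at ctop
  have hmid : ∀ k, k ≤ n → Wc T (m - 1) k 3 = k := by
    apply hT.sup_hi (by rw [Finset.mem_Icc]; omega) (by omega) hm
    rw [ctop]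
    split_ifs <;> omega
  have hlow : ∀ a, 1 ≤ a → a < m - 2 → ∀ k, k ≤ n → Wc T a k 3 = 0 := by
    intro a h1 h2
    apply hT.sup_lo (by rw [Finset.mem_Icc]; omega) (by omega) hm
    rw [ctop]
    split_ifs <;> omega
  have tot : ∀ k, k ≤ n → Wc T (m - 2) k 3 + Wc T m k 3 = k := by
    intro k hk
    have hlet : ∀ i, 1 ≤ i → i ≤ 2 → ∀ j, 1 ≤ j → j ≤ k → 
        T i j k = m - 2 ∨ T i j k = m - 1 ∨ T i j k = m := by
      intro i hi hi2 j hj hjk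
      have h1 := hT.mem i j k hi (by omega) hj hjk hk
      rw [Finset.mem_Icc] at h1
      by_contra hcon
      have h2 := hlow _ h1.1 (by omega) k hk
      have h3 := Wc_mono T (T i j k) k (show i + 1 ≤ 3 by omega)
      rw [Wc_succ _ _ _ _ hi] at h3
      exact cnt_eq_zero (show cnt T (T i j k) k i k = 0 by omega) j hj hjk rfl
    have c1 := cnt3 (show m - 2 ≠ m - 1 by omega) (show m - 2 ≠ m by omega) 
      (show m - 1 ≠ m by omega) (hlet 1 (by omega) (by omega))
    have c2 := cnt3 (show m - 2 ≠ m - 1 by omega) (show m - 2 ≠ m by omega) 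
      (show m - 1 ≠ m by omega) (hlet 2 (by omega) (by omega))
    have h1 := hmid k hk
    rw [Wc_succ _ _ _ _ (by omega), Wc_succ _ _ _ _ (by omega), Wc_one] at h1 ⊢
    rw [Wc_succ _ m _ _ (by omega), Wc_succ _ _ _ _ (by omega), Wc_one]
    omega
  set b : ℕ → ℕ := fun k => if Wc T (m - 2) k 3 = Wc T (m - 2) (k - 1) 3 then m - 2 else m 
    with hbdef
  have hb2 : ∀ k, b k = m - 2 ∨ b k = m := by
    intro k
    simp only [hbdef]
    split_ifs <;> omega
  have hb : ∀ k, k < n → ∀ a, m - 2 ≤ a → a ≤ m → 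
      Wc T a (k + 1) 3 + (if b (k + 1) = a then 1 else 0) = Wc T a k 3 + 1 := by
    intro k hk a h1 h2
    have hs := hT.step (k := k) (a := m - 2) (i := 3) hk (by rw [Finset.mem_Icc]; omega) 
      (by omega) hm
    have t1 := tot k hk.le
    have t2 := tot (k + 1) hk
    have u1 := hmid k hk.le
    have u2 := hmid (k + 1) hk
    obtain h | h | h : a = m - 2 ∨ a = m - 1 ∨ a = m := by omega
    all_goals
      subst h
      simp only [hbdef, Nat.add_sub_cancel]
      split_ifs <;> omega
  set R : ℕ → ℕ → ℕ → ℕ := fun i j k => if i ≤ 2 then T i j k else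
    if i = 3 ∧ 1 ≤ j ∧ j ≤ k ∧ k ≤ n then b (k + 1 - j) else 0 with hRdef
  set S : ℕ → ℕ → ℕ → ℕ := fun i j k => if i = 0 then 0 else if i = 1 then
    (if 1 ≤ j ∧ j ≤ k ∧ k ≤ n then swapLet m (b j) else 0) else T (i + 1) j k with hSdef
  have hR1 : ∀ i j k, 1 ≤ i → i ≤ 2 → 1 ≤ j → j ≤ k → k ≤ n → R i j k = T i j k := by
    intro i j k _ h _ _ _
    simp only [hRdef, if_pos h]
  have hR3 : ∀ j k, 1 ≤ j → j ≤ k → k ≤ n → R 3 j k = b (k + 1 - j) := by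
    intro j k h1 h2 h3
    simp [hRdef, h1, h2, h3]
  have hS1 : ∀ j k, 1 ≤ j → j ≤ k → k ≤ n → S 1 j k = swapLet m (b j) := by
    intro j k h1 h2 h3
    simp [hSdef, h1, h2, h3]
  have hS2 : ∀ i j k, 2 ≤ i → i ≤ m - 1 → 1 ≤ j → j ≤ k → k ≤ n → S i j k = T (i + 1) j k := by
    intro i j k h _ _ _ _
    simp only [hSdef]
    rw [if_neg (by omega), if_neg (by omega)]
  obtain ⟨gR, gS⟩ := good_split hm hT hmid hlow hb2 hb hR1 hR3 hS1 hS2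
  refine ⟨(R, S), ⟨fun j => R 3 j n, ?_, ⟨gR.isITAS, ?_, ?_⟩, ⟨gS.isITAS, ?_, ?_⟩⟩,
    ?_, ?_, ?_, hS2⟩
  · ext a
    rw [count_strMS n a _ R 3 (fun _ _ _ => rfl)]
    have hW : Wc R a n 3 = Wc T a n 3 := Wc_congr (by
      intro i' j' h1 h2 h3 h4
      exact hR1 i' j' n h1 (by omega) h3 h4 le_rfl)
    rw [ctop] at hW
    simp only [Multiset.count_add, Multiset.count_replicate]
    by_cases ha : m - 2 ≤ a ∧ a ≤ m
    · have h1 := gR.tot n le_rfl a (by rw [Finset.mem_Icc]; omega)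
      rw [Wc_succ _ _ _ _ (by omega), hW] at h1
      split_ifs at h1 ⊢ <;> omega
    · rw [cnt_zero_of, if_neg (by omega), if_neg (by omega)]
      intro j h1 h2 h3
      have := gR.mem 3 j n (by omega) le_rfl h1 h2 le_rfl
      rw [Finset.mem_Icc] at this
      omega
  · intro i j hi hi3 hj hjn
    obtain rfl | rfl | rfl : i = 1 ∨ i = 2 ∨ i = 3 := by omega
    · simp only [if_true]
      rw [hR1 _ _ _ (by omega) (by omega) hj hjn le_rfl]
      exact htop 1 j (by omega) (by omega) hj hjn
    · simp only [if_true, OfNat.ofNat_ne_one, if_false]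
      rw [hR1 _ _ _ (by omega) (by omega) hj hjn le_rfl]
      exact htop 2 j (by omega) (by omega) hj hjn
    · simp
  · intro i j k h
    simp only [hRdef]
    split_ifs with h1 h2
    · apply hoff; omega
    · omega
    · rfl
  · intro i j hi hi3 hj hjn
    simp only
    split_ifs with h1
    · subst h1
      rw [hS1 j n hj hjn le_rfl, hR3 _ _ (by omega) (by omega) le_rfl]
      congr 2
      omega
    · rw [hS2 i j n (by omega) hi3 hj hjn le_rfl]
      exact htop (i + 1) j (by omega) (by omega) hj hjn
  · intro i j k h
    simp only [hSdef]
    split_ifs with h1 h2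
    · rfl
    · omega
    · rfl
    · apply hoff; omega
  · intro j k h1 h2 h3
    exact ⟨hR1 1 j k (by omega) (by omega) h1 h2 h3, hR1 2 j k (by omega) (by omega) h1 h2 h3⟩
  · intro j k h1 h2 h3
    simp only
    rw [hR3 _ _ (by omega) h2 h3, hR3 _ _ (by omega) (by omega) (by omega)]
    congr 1
    omega
  · intro j k h1 h2 h3
    simp only
    rw [hS1 j k h1 h2 h3, hR3 _ _ (by omega) (by omega) h3]
    congr 2
    omega

theorem split_unique (m n : ℕ) (d : ℕ → ℕ) (lam : ℕ → ℕ → ℕ)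
    (T R S R' S' : ℕ → ℕ → ℕ → ℕ) 
    (h : (R, S) ∈ SplitTarget m n d lam) (hs : SplitRel m n T R S)
    (h' : (R', S') ∈ SplitTarget m n d lam) (hs' : SplitRel m n T R' S') :
    R = R' ∧ S = S' := by
  obtain ⟨mu, -, ⟨hR, -, zR⟩, ⟨-, -, zS⟩⟩ := h
  obtain ⟨mu', -, ⟨hR', -, zR'⟩, ⟨-, -, zS'⟩⟩ := h'
  simp only at hR hR' zR zR' zS zS'
  obtain ⟨a1, a2, a3, a4⟩ := hs
  obtain ⟨b1, b2, b3, b4⟩ := hs'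
  have gR := Good_of hR
  have gR' := Good_of hR'
  have hW : ∀ a k, k ≤ n → Wc R a k 3 = Wc R' a k 3 := by
    intro a k hk
    apply Wc_congr
    intro i' j' h1 h2 h3 h4
    obtain rfl | rfl : i' = 1 ∨ i' = 2 := by omega
    · rw [(a1 j' k h3 h4 hk).1, (b1 j' k h3 h4 hk).1]
    · rw [(a1 j' k h3 h4 hk).2, (b1 j' k h3 h4 hk).2]
  have h31 : ∀ k, k < n → R 3 1 (k + 1) = R' 3 1 (k + 1) := by
    intro k hk
    have hmem := gR.mem 3 1 (k + 1) (by omega) le_rfl le_rfl (by omega) hk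
    have s1 := star gR hk hmem (fun j g1 g2 => a2 (j + 1) (k + 1) (by omega) (by omega) hk)
    have s2 := star gR' hk hmem (fun j g1 g2 => b2 (j + 1) (k + 1) (by omega) (by omega) hk)
    rw [hW _ (k + 1) hk, hW _ k hk.le] at s1
    rw [if_pos rfl] at s1
    by_contra hcon
    rw [if_neg (fun e => hcon e.symm)] at s2
    omega
  have h3 : ∀ j k, 1 ≤ j → j ≤ k → k ≤ n → R 3 j k = R' 3 j k := by
    intro j
    induction j with
    | zero => intro k h; omega
    | succ j ih =>
      intro k _ hjk hk
      obtain ⟨k, rfl⟩ : ∃ l, k = l + 1 := ⟨k - 1, by omega⟩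
      by_cases hj : j = 0
      · subst hj; exact h31 k hk
      · rw [a2 _ _ (by omega) hjk hk, b2 _ _ (by omega) hjk hk]
        exact ih k (by omega) (by omega) (by omega)
  have hRR : R = R' := by
    funext i j k
    by_cases hb : 1 ≤ i ∧ i ≤ 3 ∧ 1 ≤ j ∧ j ≤ k ∧ k ≤ n
    · obtain ⟨c1, c2, c3, c4, c5⟩ := hb
      obtain rfl | rfl | rfl : i = 1 ∨ i = 2 ∨ i = 3 := by omega
      · rw [(a1 j k c3 c4 c5).1, (b1 j k c3 c4 c5).1]
      · rw [(a1 j k c3 c4 c5).2, (b1 j k c3 c4 c5).2]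
      · exact h3 j k c3 c4 c5
    · rw [zR i j k hb, zR' i j k hb]
  refine ⟨hRR, ?_⟩
  funext i j k
  by_cases hb : 1 ≤ i ∧ i ≤ m - 1 ∧ 1 ≤ j ∧ j ≤ k ∧ k ≤ n
  · obtain ⟨c1, c2, c3, c4, c5⟩ := hb
    by_cases hi : i = 1
    · subst hi
      rw [a3 j k c3 c4 c5, b3 j k c3 c4 c5, hRR]
    · rw [a4 i j k (by omega) c2 c3 c4 c5, b4 i j k (by omega) c2 c3 c4 c5]
  · rw [zS i j k hb, zS' i j k hb]

theorem glue_exists (m n : ℕ) (hm : 3 ≤ m) (d : ℕ → ℕ) (lam : ℕ → ℕ → ℕ)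
    (R S : ℕ → ℕ → ℕ → ℕ) (h : (R, S) ∈ SplitTarget m n d lam) :
    ∃ T, T ∈ ITASet (Finset.Icc 1 m) m n lam ∧ SplitRel m n T R S := by
  obtain ⟨mu, hmu, ⟨hR, tR, zR⟩, ⟨hS, tS, zS⟩⟩ := h
  simp only at hR hS tR tS zR zS
  have gR := Good_of hR
  have gS := Good_of hS
  have hmu2 : ∀ j, 1 ≤ j → j ≤ n → mu j = m - 2 ∨ mu j = m := by
    intro j h1 h2
    have : mu j ∈ strMS n mu :=
      Multiset.mem_map_of_mem mu (show j ∈ Finset.Icc 1 n from Finset.mem_Icc.2 ⟨h1, h2⟩)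
    rw [hmu, Multiset.mem_add] at this
    exact this.imp Multiset.eq_of_mem_replicate Multiset.eq_of_mem_replicate
  have r3 : ∀ j, 1 ≤ j → j ≤ n → R 3 j n = mu j := by
    intro j h1 h2
    rw [tR 3 j (by omega) le_rfl h1 h2]
    simp
  set T : ℕ → ℕ → ℕ → ℕ := fun i j k => if i ≤ 2 then R i j k else S (i - 1) j k with hTdef
  have hT1 : ∀ i j k, 1 ≤ i → i ≤ 2 → 1 ≤ j → j ≤ k → k ≤ n → T i j k = R i j k := by
    intro i j k _ h _ _ _
    simp only [hTdef, if_pos h]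
  have hT2 : ∀ i j k, 2 ≤ i → i ≤ m - 1 → 1 ≤ j → j ≤ k → k ≤ n → S i j k = T (i + 1) j k := by
    intro i j k h _ _ _ _
    simp only [hTdef]
    rw [if_neg (by omega), Nat.add_sub_cancel]
  obtain ⟨gT, hrel⟩ := good_glue hm gR gS
    (fun j h1 h2 => by rw [r3 j h1 h2]; exact hmu2 j h1 h2)
    (fun j h1 h2 => by
      rw [tS 1 j le_rfl (by omega) h1 h2, if_pos rfl, r3 _ (by omega) (by omega)]) hT1 hT2
  refine ⟨T, ⟨gT.isITAS, ?_, ?_⟩, hrel⟩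
  · intro i j hi him hj hjn
    by_cases h : i ≤ 2
    · rw [hT1 i j n hi h hj hjn le_rfl, tR i j hi (by omega) hj hjn]
      obtain rfl | rfl : i = 1 ∨ i = 2 := by omega
      · simp
      · simp
    · obtain ⟨i, rfl⟩ : ∃ l, i = l + 1 := ⟨i - 1, by omega⟩
      rw [← hT2 i j n (by omega) (by omega) hj hjn le_rfl, 
        tS i j (by omega) (by omega) hj hjn, if_neg (by omega)]
  · intro i j k hb
    simp only [hTdef]
    split_ifs with h
    · apply zR; omega
    · apply zS; omega

theorem glue_unique (m n : ℕ) (lam : ℕ → ℕ → ℕ)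
    (T T' R S : ℕ → ℕ → ℕ → ℕ) 
    (h : T ∈ ITASet (Finset.Icc 1 m) m n lam) (hs : SplitRel m n T R S)
    (h' : T' ∈ ITASet (Finset.Icc 1 m) m n lam) (hs' : SplitRel m n T' R S) :
    T = T' := by
  obtain ⟨a1, -, -, a4⟩ := hs
  obtain ⟨b1, -, -, b4⟩ := hs'
  funext i j k
  by_cases hb : 1 ≤ i ∧ i ≤ m ∧ 1 ≤ j ∧ j ≤ k ∧ k ≤ n
  · obtain ⟨c1, c2, c3, c4, c5⟩ := hb
    by_cases h1 : i = 1
    · subst h1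
      rw [← (a1 j k c3 c4 c5).1, ← (b1 j k c3 c4 c5).1]
    by_cases h2 : i = 2
    · subst h2
      rw [← (a1 j k c3 c4 c5).2, ← (b1 j k c3 c4 c5).2]
    obtain ⟨i, rfl⟩ : ∃ l, i = l + 1 := ⟨i - 1, by omega⟩
    rw [← a4 i j k (by omega) (by omega) c3 c4 c5, ← b4 i j k (by omega) (by omega) c3 c4 c5]
  · rw [h.2.2 i j k hb, h'.2.2 i j k hb]

/-- The splitting lemma: for `m ≥ 3`, dimensions `0 = d_0 ≤ d_1 ≤ ⋯ ≤ d_m = n`, and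
top rows `λ^(i)` of type `(m-i)^(d_(m-i)) m^(d_(m-i+1) - d_(m-i)) (m-i+1)^(n - d_(m-i+1))`,
the splitting construction is a bijection from `𝒯_(m,n)(λ^(1),…,λ^(m))` onto
`⨆_μ 𝒯^({m-2,m-1,m})_(3,n)(λ^(1),λ^(2),μ) × 𝒯^({1,…,m}∖{m-1})_(m-1,n)(μ†,λ^(3),…,λ^(m))`;
in particular the corresponding cardinalities agree. -/
theorem splitting_lemma (m n : ℕ) (hm : 3 ≤ m) (d : ℕ → ℕ)
    (hd0 : d 0 = 0) (hdm : d m = n) (hmono : ∀ i, i < m → d i ≤ d (i + 1))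
    (lam : ℕ → ℕ → ℕ)
    (hlam : ∀ i, 1 ≤ i → i ≤ m →
        strMS n (lam i) =
          Multiset.replicate (d (m - i)) (m - i) +
          Multiset.replicate (d (m - i + 1) - d (m - i)) m +
          Multiset.replicate (n - d (m - i + 1)) (m - i + 1)) :
    (∀ T ∈ ITASet (Finset.Icc 1 m) m n lam,
        ∃! RS : (ℕ → ℕ → ℕ → ℕ) × (ℕ → ℕ → ℕ → ℕ),
          RS ∈ SplitTarget m n d lam ∧ SplitRel m n T RS.1 RS.2) ∧
    (∀ RS ∈ SplitTarget m n d lam,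
        ∃! T, T ∈ ITASet (Finset.Icc 1 m) m n lam ∧ SplitRel m n T RS.1 RS.2) ∧
    (ITASet (Finset.Icc 1 m) m n lam).ncard = (SplitTarget m n d lam).ncard := by
  have hE := split_exists m n hm d hdm hmono lam hlam
  have hU : ∀ T RS RS', RS ∈ SplitTarget m n d lam → SplitRel m n T RS.1 RS.2 →
      RS' ∈ SplitTarget m n d lam → SplitRel m n T RS'.1 RS'.2 → RS = RS' := by
    intro T RS RS' h1 h2 h3 h4
    obtain ⟨h5, h6⟩ := split_unique m n d lam T RS.1 RS.2 RS'.1 RS'.2 h1 h2 h3 h4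
    exact Prod.ext h5 h6
  have hG : ∀ RS ∈ SplitTarget m n d lam,
      ∃ T, T ∈ ITASet (Finset.Icc 1 m) m n lam ∧ SplitRel m n T RS.1 RS.2 :=
    fun RS h => glue_exists m n hm d lam RS.1 RS.2 h
  refine ⟨?_, ?_, ?_⟩
  · intro T hT
    obtain ⟨RS, h1, h2⟩ := hE T hT
    exact ⟨RS, ⟨h1, h2⟩, fun RS' h => hU T RS' RS h.1 h.2 h1 h2⟩
  · intro RS hRS
    obtain ⟨T, h1, h2⟩ := hG RS hRS
    exact ⟨T, ⟨h1, h2⟩, fun T' h => glue_unique m n lam T' T _ _ h.1 h.2 h1 h2⟩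
  · choose f hf1 hf2 using hE
    refine Set.ncard_congr f hf1 ?_ ?_
    · intro T T' h h' e
      refine glue_unique m n lam T T' _ _ h (hf2 T h) h' ?_
      rw [e]
      exact hf2 T' h'
    · intro RS hRS
      obtain ⟨T, h1, h2⟩ := hG RS hRS
      exact ⟨T, h1, hU T _ _ (hf1 T h1) (hf2 T h1) hRS h2⟩
end
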